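/- arXiv:2507.17714 — 2 statements merged into one kernel-verified Lean document; each statement's English description precedes it below -/
import Mathlib

section
/- Let Ω₁, Ω₂ ⊂ ℝⁿ be open and bounded, and let F_j, F : Ω̄₁ → Ω̄₂ (j ≥ 1) satisfy: (i) sup_j Lip(F_j|_{Ω₁}) < ∞; (ii) the restrictions F|_{Ω₁} and F_j|_{Ω₁} are injective; (iii) F_j → F pointwise on Ω₁; (iv) F_j(∂Ω₁) ⊂ ∂Ω₂, F_j(Ω₁) = Ω₂ for all j, and F(Ω₁) = Ω₂. Then the inverse maps converge pointwise: F_j⁻¹(y) → F⁻¹(y) for every y ∈ Ω₂. -/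
open Set Filter

section Retraction

open MeasureTheory Metric Module

variable {E : Type*} [NormedAddCommGroup E] [InnerProductSpace ℝ E]

lemma dist_radial_projection_le (x y : E) :
    dist ((max 1 ‖x‖)⁻¹ • x) ((max 1 ‖y‖)⁻¹ • y) ≤ 2 * dist x y := by
  set a := max 1 ‖x‖
  set b := max 1 ‖y‖
  have ha : 1 ≤ a := le_max_left _ _
  have hb : 1 ≤ b := le_max_left _ _
  have hxa : ‖x‖ ≤ a := le_max_right _ _
  have hab : |b - a| ≤ dist x y := by
    refine (abs_max_sub_max_le_max _ _ _ _).trans (max_le (by simp) ?_)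
    rw [dist_comm, dist_eq_norm]
    exact abs_norm_sub_norm_le y x
  have key : a⁻¹ • x - b⁻¹ • y = b⁻¹ • (x - y) + ((b - a) * b⁻¹) • (a⁻¹ • x) := by
    have : (b - a) * b⁻¹ * a⁻¹ = a⁻¹ - b⁻¹ := by field_simp
    rw [smul_smul, this, smul_sub, sub_smul]
    abel
  rw [dist_eq_norm, key]
  have hb1 : b⁻¹ ≤ 1 := inv_le_one_of_one_le₀ hb
  have hb0 : 0 ≤ b⁻¹ := by positivity
  have h1 : ‖a⁻¹ • x‖ ≤ 1 := by
    rw [norm_smul, Real.norm_of_nonneg (by positivity), inv_mul_le_one₀ (by positivity)]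
    exact hxa
  calc _ ≤ ‖b⁻¹ • (x - y)‖ + ‖((b - a) * b⁻¹) • (a⁻¹ • x)‖ := norm_add_le _ _
    _ ≤ 1 * dist x y + (dist x y * 1) * 1 := by
      rw [norm_smul b⁻¹, norm_smul ((b - a) * b⁻¹), norm_mul, Real.norm_of_nonneg hb0,
        ← dist_eq_norm, Real.norm_eq_abs]
      gcongr
    _ = _ := by ring

variable [FiniteDimensional ℝ E]

lemma exists_polynomial_eval_eq_det_one_add_smul (A : E →L[ℝ] E) :
    ∃ p : Polynomial ℝ, p.natDegree ≤ finrank ℝ E ∧ ∀ t : ℝ, p.eval t = (1 + t • A).det := by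
  let b := finBasis ℝ E
  let M := LinearMap.toMatrix b b (A : E →ₗ[ℝ] E)
  refine ⟨(Polynomial.X • M.map Polynomial.C +
      (1 : Matrix (Fin (finrank ℝ E)) (Fin (finrank ℝ E)) ℝ).map Polynomial.C).det,
    by simpa using Polynomial.natDegree_det_X_add_C_le M 1, fun t ↦ ?_⟩
  rw [← Polynomial.coe_evalRingHom, RingHom.map_det]
  change _ = LinearMap.det (((1 + t • A : E →L[ℝ] E)) : E →ₗ[ℝ] E)
  rw [← LinearMap.det_toMatrix b]
  congr 1
  ext i j
  simp [M, LinearMap.toMatrix_apply, Matrix.one_apply, Finsupp.single_apply, eq_comm, apply_ite,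
    add_comm]
  ring

lemma det_one_add_eq_sum_lagrange (A : E →L[ℝ] E) {s : Finset ℝ}
    (hs : finrank ℝ E < s.card) :
    (1 + A).det = ∑ t ∈ s, (Lagrange.basis s id t).eval 1 * (1 + t • A).det := by
  obtain ⟨p, hp, hpe⟩ := exists_polynomial_eval_eq_det_one_add_smul A
  have h := Lagrange.eq_interpolate_of_eval_eq (s := s) (v := id)
    (fun t : ℝ ↦ (1 + t • A).det) (f := p) Function.injective_id.injOn
    (p.degree_le_natDegree.trans_lt (by exact_mod_cast hp.trans_lt hs)) (fun t _ ↦ hpe t)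
  have h1 := hpe 1
  rw [one_smul] at h1
  rw [← h1, h, Lagrange.interpolate_apply, Polynomial.eval_finsetSum]
  exact Finset.sum_congr rfl fun t _ ↦ by simp [mul_comm]

lemma det_one_add_pos {A : E →L[ℝ] E} (hA : ‖A‖ < 1) : 0 < (1 + A).det := by
  by_contra! h
  have hc : ContinuousOn (fun s : ℝ ↦ (1 + s • A).det) (Icc 0 1) :=
    (ContinuousLinearMap.continuous_det.comp (by fun_prop)).continuousOn
  obtain ⟨s, hs, h0⟩ := isPreconnected_Icc.intermediate_value
    (right_mem_Icc.2 zero_le_one) (left_mem_Icc.2 zero_le_one) hc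
    (show (0 : ℝ) ∈ _ from ⟨by simpa using h, by
      simp only [zero_smul, add_zero]
      change 0 ≤ LinearMap.det (LinearMap.id : E →ₗ[ℝ] E)
      simp⟩)
  have hu : IsUnit (1 - -(s • A)) := isUnit_one_sub_of_norm_lt_one <| by
    rw [norm_neg, norm_smul, Real.norm_of_nonneg hs.1]
    nlinarith [norm_nonneg A, hs.2, hs.1]
  rw [sub_neg_eq_add] at hu
  have h1 := (hu.map (ContinuousLinearMap.toLinearMapRingHom : (E →L[ℝ] E) →+* E →ₗ[ℝ] E)).map
    (LinearMap.det : (E →ₗ[ℝ] E) →* ℝ)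
  exact h1.ne_zero h0

variable [MeasurableSpace E] [BorelSpace E]

/-- A small Lipschitz perturbation of the identity which vanishes outside the unit ball preserves
the volume of the unit ball. -/
lemma integral_det_one_add_smul_fderiv {g : E → E} {L : NNReal} (hg : LipschitzWith L g)
    (hg0 : ∀ x, x ∉ ball (0 : E) 1 → g x = 0) {t : ℝ} (ht0 : 0 ≤ t) (ht : t * L < 1) :
    IntegrableOn (fun x ↦ (1 + t • fderiv ℝ g x).det)
      (ball 0 1 ∩ {x | DifferentiableAt ℝ g x}) ∧
    ∫ x in ball 0 1 ∩ {x | DifferentiableAt ℝ g x}, (1 + t • fderiv ℝ g x).det =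
      volume.real (ball (0 : E) 1) := by
  set D := {x | DifferentiableAt ℝ g x}
  set f : E → E := fun x ↦ x + t • g x
  have hD : MeasurableSet (ball (0 : E) 1 ∩ D) :=
    measurableSet_ball.inter (measurableSet_of_differentiableAt ℝ g)
  have hfl : LipschitzWith (1 + t.toNNReal * L) f := by
    have h2 : LipschitzWith (t.toNNReal * L) fun x ↦ t • g x :=
      LipschitzWith.of_dist_le_mul fun x y ↦ by
        rw [dist_smul₀, NNReal.coe_mul, Real.coe_toNNReal t ht0, Real.norm_of_nonneg ht0, mul_assoc]
        exact mul_le_mul_of_nonneg_left (hg.dist_le_mul x y) ht0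
    exact LipschitzWith.id.add h2
  have happ : ApproximatesLinearOn f (ContinuousLinearEquiv.refl ℝ E : E →L[ℝ] E) univ
      (t.toNNReal * L) := by
    intro x _ y _
    have : f x - f y - (x - y) = t • (g x - g y) := by simp only [f, smul_sub]; abel
    simp only [ContinuousLinearEquiv.coe_refl, ContinuousLinearMap.coe_id', id_eq]
    rw [this, norm_smul, NNReal.coe_mul, Real.coe_toNNReal t ht0, Real.norm_of_nonneg ht0,
      mul_assoc]
    exact mul_le_mul_of_nonneg_left (hg.norm_sub_le x y) ht0
  have hbij : Function.Bijective f := by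
    rcases subsingleton_or_nontrivial E with hE | hE
    · exact ⟨fun _ _ _ ↦ Subsingleton.elim _ _, fun y ↦ ⟨y, Subsingleton.elim _ _⟩⟩
    refine (happ.toHomeomorph f (Or.inr ?_)).bijective
    have : ‖((ContinuousLinearEquiv.refl ℝ E).symm : E →L[ℝ] E)‖₊ = 1 := by
      simp
    rw [this, inv_one, ← NNReal.coe_lt_coe]
    simpa [Real.coe_toNNReal t ht0] using ht
  have hball : f '' ball 0 1 = ball 0 1 := by
    rw [← compl_inj_iff, ← image_compl_eq hbij]
    have : EqOn f id (ball (0 : E) 1)ᶜ := fun x hx ↦ by simp [f, hg0 x hx]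
    rw [this.image_eq, image_id]
  have himg : volume (f '' (ball 0 1 ∩ D)) = volume (ball (0 : E) 1) := by
    refine le_antisymm (measure_mono ((image_mono inter_subset_left).trans hball.subset)) ?_
    have hnull : volume (f '' Dᶜ) = 0 := by
      have h0 : Measure.hausdorffMeasure (finrank ℝ E) Dᶜ = 0 :=
        hg.ae_differentiableAt (μ := Measure.hausdorffMeasure (finrank ℝ E))
      refine Measure.absolutelyContinuous_isAddHaarMeasure volume
        (Measure.hausdorffMeasure (finrank ℝ E)) (le_antisymm ?_ zero_le)
      exact (hfl.hausdorffMeasure_image_le (by positivity) _).trans_eq (by rw [h0, mul_zero])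
    calc volume (ball (0 : E) 1) ≤ volume (f '' (ball 0 1 ∩ D) ∪ f '' Dᶜ) := by
          refine measure_mono ?_
          rw [← image_union]
          refine hball.symm.subset.trans (image_mono fun x hx ↦ ?_)
          exact (em (x ∈ D)).imp (⟨hx, ·⟩) id
      _ ≤ _ := (measure_union_le _ _).trans (by simp [hnull])
  have hder : ∀ x ∈ ball (0 : E) 1 ∩ D,
      HasFDerivWithinAt f (1 + t • fderiv ℝ g x) (ball 0 1 ∩ D) x := fun x hx ↦
    ((hasFDerivAt_id x).add (hx.2.hasFDerivAt.const_smul t)).hasFDerivWithinAt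
  have hpos : ∀ x, 0 < (1 + t • fderiv ℝ g x).det := fun x ↦ det_one_add_pos <| by
    rw [norm_smul, Real.norm_of_nonneg ht0]
    exact (mul_le_mul_of_nonneg_left (norm_fderiv_le_of_lipschitz ℝ hg) ht0).trans_lt ht
  have hint := integrableOn_image_iff_integrableOn_abs_det_fderiv_smul volume hD hder
    hbij.1.injOn (fun _ ↦ (1 : ℝ))
  have heq := integral_image_eq_integral_abs_det_fderiv_smul volume hD hder
    hbij.1.injOn (fun _ ↦ (1 : ℝ))
  simp only [abs_of_pos (hpos _), smul_eq_mul, mul_one] at hint heq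
  refine ⟨hint.1 (integrableOn_const (by rw [himg]; exact measure_ball_lt_top.ne)), ?_⟩
  rw [← heq]
  simp [Measure.real, himg]

/-- There is no Lipschitz retraction of the closed unit ball onto the unit sphere. -/
theorem not_exists_lipschitz_retraction {r : E → E} {K : NNReal}
    (hr : LipschitzOnWith K r (closedBall 0 1)) (hr1 : ∀ x ∈ closedBall (0 : E) 1, ‖r x‖ = 1)
    (hrs : ∀ x ∈ sphere (0 : E) 1, r x = x) : False := by
  set P : E → E := fun x ↦ (max 1 ‖x‖)⁻¹ • x
  have hPl : LipschitzWith 2 P := LipschitzWith.of_dist_le_mul dist_radial_projection_le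
  have hPb : ∀ x, P x ∈ closedBall (0 : E) 1 := fun x ↦ by
    rw [mem_closedBall_zero_iff, norm_smul, Real.norm_of_nonneg (by positivity),
      inv_mul_le_one₀ (by positivity)]
    exact le_max_right _ _
  have hPin : ∀ x ∈ ball (0 : E) 1, P x = x := fun x hx ↦ by
    simp [P, max_eq_left (mem_ball_zero_iff.1 hx).le]
  have hPout : ∀ x, x ∉ ball (0 : E) 1 → P x ∈ sphere (0 : E) 1 := fun x hx ↦ by
    have hx1 : 1 ≤ ‖x‖ := by simpa using hx
    rw [mem_sphere_zero_iff_norm, norm_smul, max_eq_right hx1, norm_inv, norm_norm,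
      inv_mul_cancel₀ (by positivity)]
  set g : E → E := fun x ↦ r (P x) - P x
  obtain ⟨L, hg⟩ : ∃ L, LipschitzWith L g :=
    ⟨_, (lipschitzOnWith_univ.1 (hr.comp hPl.lipschitzOnWith fun x _ ↦ hPb x)).sub hPl⟩
  have hg0 : ∀ x, x ∉ ball (0 : E) 1 → g x = 0 := fun x hx ↦ by
    simp [g, hrs _ (hPout x hx)]
  obtain ⟨s, hsub, hcard⟩ := (Ioo_infinite (show (0 : ℝ) < 1 / (L + 1) by positivity))
    |>.exists_subset_card_eq (finrank ℝ E + 1)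
  have hts : ∀ t ∈ s, 0 ≤ t ∧ t * L < 1 := fun t ht ↦ by
    have h := hsub ht
    refine ⟨h.1.le, ?_⟩
    have h2 := (lt_div_iff₀ (by positivity)).1 h.2
    nlinarith [h.1]
  set S := ball (0 : E) 1 ∩ {x | DifferentiableAt ℝ g x}
  have hS : MeasurableSet S := measurableSet_ball.inter (measurableSet_of_differentiableAt ℝ g)
  have hdet : ∀ x ∈ S, (1 + fderiv ℝ g x).det = 0 := by
    rintro x ⟨hxb, hxd⟩
    have hloc : (fun y ↦ y + g y) =ᶠ[nhds x] r := by
      filter_upwards [isOpen_ball.mem_nhds hxb] with y hy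
      simp [g, hPin y hy]
    have hder : HasFDerivAt r (1 + fderiv ℝ g x) x :=
      ((hasFDerivAt_id x).add hxd.hasFDerivAt).congr_of_eventuallyEq hloc.symm
    have hconst : (fun y ↦ ‖r y‖ ^ 2) =ᶠ[nhds x] fun _ ↦ 1 := by
      filter_upwards [isOpen_ball.mem_nhds hxb] with y hy
      simp [hr1 y (ball_subset_closedBall hy)]
    have h0 := (hder.norm_sq.congr_of_eventuallyEq hconst.symm).unique (hasFDerivAt_const _ _)
    by_contra hne
    have hsurj : Function.Surjective (1 + fderiv ℝ g x : E →L[ℝ] E) :=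
      (LinearMap.equivOfDetNeZero (1 + fderiv ℝ g x : E →L[ℝ] E).toLinearMap hne).surjective
    obtain ⟨v, hv⟩ := hsurj (r x)
    have h1 := DFunLike.congr_fun h0 v
    simp only [smul_apply, ContinuousLinearMap.comp_apply, hv] at h1
    simp [hr1 x (ball_subset_closedBall hxb)] at h1
  have hzero : ∫ x in S, (1 + fderiv ℝ g x).det = 0 :=
    setIntegral_eq_zero_of_forall_eq_zero hdet
  have hsum : ∫ x in S, (1 + fderiv ℝ g x).det = volume.real (ball (0 : E) 1) := by
    have hd : ∀ x, (1 + fderiv ℝ g x).det = _ := fun x ↦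
      det_one_add_eq_sum_lagrange (fderiv ℝ g x) (s := s) (by omega)
    simp_rw [hd]
    rw [integral_finsetSum _ fun t ht ↦
      (integral_det_one_add_smul_fderiv hg hg0 (hts t ht).1 (hts t ht).2).1.const_mul _]
    rw [Finset.sum_congr rfl fun t ht ↦ by
      rw [integral_const_mul,
        (integral_det_one_add_smul_fderiv hg hg0 (hts t ht).1 (hts t ht).2).2]]
    rw [← Finset.sum_mul, ← Polynomial.eval_finsetSum, Lagrange.sum_basis Function.injective_id.injOn
      (Finset.card_pos.1 (by omega))]
    simp
  have hpos : 0 < volume.real (ball (0 : E) 1) :=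
    ENNReal.toReal_pos (measure_ball_pos _ _ one_pos).ne' measure_ball_lt_top.ne
  linarith

lemma LipschitzOnWith.exists_comp_contDiffAt {α F G : Type*} [PseudoMetricSpace α]
    [NormedAddCommGroup F] [NormedSpace ℝ F] [NormedAddCommGroup G] [NormedSpace ℝ G]
    {s : Set α} (hs : IsCompact s) {u : α → F} (hu : ∃ K, LipschitzOnWith K u s) {φ : F → G}
    (hφ : ∀ x ∈ s, ContDiffAt ℝ 1 φ (u x)) : ∃ K, LipschitzOnWith K (fun x ↦ φ (u x)) s := by
  obtain ⟨K, hK⟩ := hu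
  have hloc : LocallyLipschitzOn (u '' s) φ := by
    rintro _ ⟨x, hx, rfl⟩
    obtain ⟨C, t, ht, h⟩ := (hφ x hx).exists_lipschitzOnWith
    exact ⟨C, t, mem_nhdsWithin_of_mem_nhds ht, h⟩
  obtain ⟨C, hC⟩ := hloc.exists_lipschitzOnWith_of_compact (hs.image_of_continuousOn hK.continuousOn)
  exact ⟨_, hC.comp hK (mapsTo_image _ _)⟩

lemma LipschitzOnWith.exists_smul {α F : Type*} [PseudoMetricSpace α]
    [NormedAddCommGroup F] [NormedSpace ℝ F] {s : Set α} (hs : IsCompact s) {c : α → ℝ} {u : α → F}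
    (hc : ∃ K, LipschitzOnWith K c s) (hu : ∃ K, LipschitzOnWith K u s) :
    ∃ K, LipschitzOnWith K (fun x ↦ c x • u x) s := by
  obtain ⟨K₁, h₁⟩ := hc
  obtain ⟨K₂, h₂⟩ := hu
  exact LipschitzOnWith.exists_comp_contDiffAt hs (u := fun x ↦ (c x, u x)) ⟨_, h₁.prodMk h₂⟩
    (φ := fun p : ℝ × F ↦ p.1 • p.2) fun x _ ↦ (contDiff_fst.smul contDiff_snd).contDiffAt

/-- A Lipschitz map of the closed unit ball which is uniformly close to the identity vanishes
somewhere. -/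
theorem exists_eq_zero_of_norm_sub_le {h : E → E} {K : NNReal}
    (hl : LipschitzOnWith K h (closedBall 0 1))
    (hh : ∀ x ∈ closedBall (0 : E) 1, ‖h x - x‖ ≤ 1 / 2) :
    ∃ x ∈ closedBall (0 : E) 1, h x = 0 := by
  by_contra! hne
  have hB : IsCompact (closedBall (0 : E) 1) := isCompact_closedBall _ _
  set χ : E → ℝ := fun x ↦ min 1 (4 * (1 - ‖x‖))
  have hχ0 : ∀ x ∈ closedBall (0 : E) 1, 0 ≤ χ x := fun x hx ↦ by
    have := mem_closedBall_zero_iff.1 hx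
    exact le_min zero_le_one (by linarith)
  set k : E → E := fun x ↦ x + χ x • (h x - x)
  have hχl : ∃ K, LipschitzOnWith K χ (closedBall 0 1) := by
    have h1 : LipschitzWith 4 fun x : E ↦ 4 * (1 - ‖x‖) :=
      LipschitzWith.of_dist_le_mul fun x y ↦ by
        rw [Real.dist_eq, show 4 * (1 - ‖x‖) - 4 * (1 - ‖y‖) = 4 * (‖y‖ - ‖x‖) by ring, abs_mul,
          dist_comm, dist_eq_norm]
        simpa using abs_norm_sub_norm_le y x
    exact ⟨_, (h1.const_min 1).lipschitzOnWith⟩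
  have hkl : ∃ K, LipschitzOnWith K k (closedBall 0 1) := by
    obtain ⟨C, hC⟩ := LipschitzOnWith.exists_smul hB hχl
      ⟨_, hl.sub LipschitzWith.id.lipschitzOnWith⟩
    exact ⟨_, LipschitzWith.id.lipschitzOnWith.add hC⟩
  have hk0 : ∀ x ∈ closedBall (0 : E) 1, k x ≠ 0 := by
    intro x hx hkx
    rcases le_or_gt ‖x‖ (3 / 4) with hx' | hx'
    · have : χ x = 1 := min_eq_left (by linarith)
      exact hne x hx (by simpa [k, this] using hkx)
    · have h1 : ‖χ x • (h x - x)‖ ≤ 1 * (1 / 2) := by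
        rw [norm_smul, Real.norm_of_nonneg (hχ0 x hx)]
        exact mul_le_mul (min_le_left _ _) (hh x hx) (norm_nonneg _) zero_le_one
      have h2 : x = -(χ x • (h x - x)) := eq_neg_of_add_eq_zero_left hkx
      have h3 := congrArg norm h2
      rw [norm_neg] at h3
      linarith
  obtain ⟨C, hC⟩ := LipschitzOnWith.exists_comp_contDiffAt hB hkl (φ := fun y : E ↦ ‖y‖⁻¹ • y)
    fun x hx ↦ ((contDiffAt_norm ℝ (hk0 x hx)).inv (norm_ne_zero_iff.2 (hk0 x hx))).smul
      contDiffAt_id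
  refine not_exists_lipschitz_retraction hC (fun x hx ↦ norm_smul_inv_norm (𝕜 := ℝ) (hk0 x hx))
    fun x hx ↦ ?_
  have hx1 : ‖x‖ = 1 := mem_sphere_zero_iff_norm.1 hx
  have : k x = x := by simp [k, χ, hx1]
  simp [this, hx1]

lemma image_closedBall_mem_nhds_of_lipschitz {f : E → E} {K : NNReal}
    (hl : LipschitzOnWith K f (closedBall 0 1)) (hf : InjOn f (closedBall 0 1)) :
    f '' closedBall 0 1 ∈ nhds (f 0) := by
  have hB : IsCompact (closedBall (0 : E) 1) := isCompact_closedBall _ _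
  have h0B : (0 : E) ∈ closedBall (0 : E) 1 := mem_closedBall_self zero_le_one
  by_contra hnot
  obtain ⟨G, hG⟩ : ∃ G : C(E, E), ∀ x ∈ closedBall (0 : E) 1, G (f x) = x := by
    have : CompactSpace (closedBall (0 : E) 1) := isCompact_iff_compactSpace.1 hB
    have he : Topology.IsClosedEmbedding ((closedBall (0 : E) 1).domRestrict f) :=
      hl.continuousOn.domRestrict.isClosedEmbedding hf.injective
    have : TietzeExtension E := TietzeExtension.of_tvs ℝ
    obtain ⟨G, hG⟩ := ContinuousMap.exists_extension' he
      (⟨Subtype.val, continuous_subtype_val⟩ : C(closedBall (0 : E) 1, E))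
    exact ⟨G, fun x hx ↦ congrFun hG ⟨x, hx⟩⟩
  obtain ⟨ε, hε, hGε⟩ : ∃ ε > 0, ∀ y, dist y (f 0) < 2 * ε → ‖G y‖ < 1 / 8 := by
    obtain ⟨η, hη, h⟩ := Metric.continuousAt_iff.1 (G.continuous.continuousAt (x := f 0)) (1 / 8)
      (by norm_num)
    refine ⟨η / 2, by positivity, fun y hy ↦ ?_⟩
    simpa [hG 0 h0B] using h (show dist y (f 0) < η by linarith)
  obtain ⟨c, hcε, hc⟩ : ∃ c, dist c (f 0) < ε ∧ c ∉ f '' closedBall 0 1 := by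
    by_contra! hcon
    exact hnot (mem_of_superset (ball_mem_nhds _ hε) hcon)
  set u : E → E := fun x ↦ f x - c
  have hul : LipschitzOnWith (K + 0) u (closedBall 0 1) :=
    hl.sub (LipschitzWith.const c).lipschitzOnWith
  have hu0 : ∀ x ∈ closedBall (0 : E) 1, u x ≠ 0 := fun x hx h ↦ hc ⟨x, hx, sub_eq_zero.1 h⟩
  set H : E → E := fun y ↦ G (y + c)
  have hHc : Continuous H := by fun_prop
  have hHu : ∀ x ∈ closedBall (0 : E) 1, H (u x) = x := fun x hx ↦ by simp [H, u, hG x hx]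
  have hHε : ∀ y, ‖y‖ ≤ ε → ‖H y‖ < 1 / 8 := fun y hy ↦ hGε _ <| by
    calc dist (y + c) (f 0) ≤ dist (y + c) c + dist c (f 0) := dist_triangle _ _ _
      _ < 2 * ε := by rw [dist_eq_norm, add_sub_cancel_right]; linarith
  obtain ⟨δ, hδ, hδH⟩ : ∃ δ > 0, ∀ y ∈ u '' closedBall 0 1 ∩ {y | ε ≤ ‖y‖}, δ ≤ ‖H y‖ := by
    refine ((hB.image_of_continuousOn hul.continuousOn).inter_right
      (isClosed_le continuous_const continuous_norm)).exists_forall_le' hHc.norm.continuousOn ?_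
    rintro _ ⟨⟨x, hx, rfl⟩, hxε⟩
    rw [hHu x hx, norm_pos_iff]
    rintro rfl
    rw [dist_comm, dist_eq_norm] at hcε
    exact absurd hxε (not_le.2 hcε)
  set γ := min δ (1 / 8)
  have hγ : 0 < γ := by positivity
  obtain ⟨P, hP, hPH, hPs⟩ : ∃ P : E → E, ContDiff ℝ 1 P ∧ (∀ y, ‖P y - H y‖ < γ) ∧
      ∀ y ∈ sphere (0 : E) ε, P y ≠ 0 := by
    obtain ⟨Q, hQ, hQH, -⟩ := hHc.exists_contDiff_approx 1 (ε := fun _ ↦ γ / 2)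
      continuous_const fun _ ↦ by positivity
    have hQn : volume (Q '' sphere (0 : E) ε) = 0 :=
      addHaar_image_eq_zero_of_differentiableOn_of_addHaar_eq_zero volume
        (hQ.differentiable (by simp)).differentiableOn
        (Measure.addHaar_sphere_of_ne_zero volume 0 hε.ne')
    obtain ⟨v, hv, hvQ⟩ : ∃ v ∈ ball (0 : E) (γ / 2), v ∉ Q '' sphere 0 ε := by
      by_contra! hcon
      exact (measure_ball_pos volume (0 : E) (half_pos hγ)).ne' (measure_mono_null hcon hQn)
    refine ⟨fun y ↦ Q y - v, hQ.sub contDiff_const, fun y ↦ ?_, fun y hy h ↦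
      hvQ ⟨y, hy, sub_eq_zero.1 h⟩⟩
    have h1 := hQH y
    rw [dist_eq_norm] at h1
    rw [mem_ball_zero_iff] at hv
    calc ‖Q y - v - H y‖ = ‖(Q y - H y) - v‖ := by congr 1; abel
      _ ≤ _ := norm_sub_le _ _
      _ < γ := by linarith
  set Φ : E → E := fun x ↦ max 1 (ε * ‖u x‖⁻¹) • u x
  have hΦl : ∃ K, LipschitzOnWith K Φ (closedBall 0 1) := by
    refine LipschitzOnWith.exists_smul hB ?_ ⟨_, hul⟩
    obtain ⟨C, hC⟩ := LipschitzOnWith.exists_comp_contDiffAt hB ⟨_, hul⟩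
      (φ := fun y : E ↦ ε * ‖y‖⁻¹) fun x hx ↦ contDiffAt_const.mul
        ((contDiffAt_norm ℝ (hu0 x hx)).inv (norm_ne_zero_iff.2 (hu0 x hx)))
    exact ⟨_, (LipschitzWith.id.const_max 1).comp_lipschitzOnWith hC⟩
  obtain ⟨C, hC⟩ := LipschitzOnWith.exists_comp_contDiffAt hB hΦl (φ := P)
    fun x _ ↦ hP.contDiffAt
  have hsmall : ∀ x ∈ closedBall (0 : E) 1, ‖u x‖ < ε → Φ x ∈ sphere (0 : E) ε := by
    intro x hx hxε
    have hpos : 0 < ‖u x‖ := norm_pos_iff.2 (hu0 x hx)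
    have hm : 1 ≤ ε * ‖u x‖⁻¹ := by rw [← div_eq_mul_inv, one_le_div hpos]; exact hxε.le
    rw [mem_sphere_zero_iff_norm, norm_smul, max_eq_right hm, Real.norm_of_nonneg (by positivity),
      inv_mul_cancel_right₀ hpos.ne']
  have hlarge : ∀ x ∈ closedBall (0 : E) 1, ε ≤ ‖u x‖ → Φ x = u x := by
    intro x hx hxε
    have hpos : 0 < ‖u x‖ := norm_pos_iff.2 (hu0 x hx)
    have hm : ε * ‖u x‖⁻¹ ≤ 1 := by rw [← div_eq_mul_inv, div_le_one hpos]; exact hxε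
    simp [Φ, max_eq_left hm]
  have hγ8 : γ ≤ 1 / 8 := min_le_right _ _
  obtain ⟨x, hx, hx0⟩ := exists_eq_zero_of_norm_sub_le hC fun x hx ↦ by
    have hPx := hPH (Φ x)
    rcases lt_or_ge ‖u x‖ ε with hxε | hxε
    · have h1 := hHε _ (mem_sphere_zero_iff_norm.1 (hsmall x hx hxε)).le
      have h2 := hHε _ hxε.le
      rw [hHu x hx] at h2
      calc ‖P (Φ x) - x‖ = ‖(P (Φ x) - H (Φ x)) + H (Φ x) - x‖ := by congr 1; abel
        _ ≤ ‖P (Φ x) - H (Φ x)‖ + ‖H (Φ x)‖ + ‖x‖ :=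
          (norm_sub_le _ _).trans (by gcongr; exact norm_add_le _ _)
        _ ≤ 1 / 2 := by linarith
    · rw [hlarge x hx hxε, hHu x hx] at hPx
      rw [hlarge x hx hxε]
      linarith
  rcases lt_or_ge ‖u x‖ ε with hxε | hxε
  · exact hPs _ (hsmall x hx hxε) hx0
  · have h1 := hPH (Φ x)
    rw [hx0, zero_sub, norm_neg, hlarge x hx hxε] at h1
    exact absurd (hδH _ ⟨mem_image_of_mem u hx, hxε⟩) (not_le.2 (h1.trans_le (min_le_left _ _)))

/-- **Invariance of domain** for Lipschitz maps. -/
theorem LipschitzOnWith.isOpen_image_of_injOn {f : E → E} {K : NNReal} {U : Set E}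
    (hl : LipschitzOnWith K f U) (hU : IsOpen U) (hf : InjOn f U) : IsOpen (f '' U) := by
  rw [isOpen_iff_mem_nhds]
  rintro _ ⟨a, ha, rfl⟩
  obtain ⟨ρ, hρ, hρU⟩ := nhds_basis_closedBall.mem_iff.1 (hU.mem_nhds ha)
  have hmaps : MapsTo (fun x : E ↦ a + ρ • x) (closedBall 0 1) U := fun x hx ↦ hρU <| by
    rw [mem_closedBall, dist_eq_norm, add_sub_cancel_left, norm_smul, Real.norm_of_nonneg hρ.le]
    exact mul_le_of_le_one_right hρ.le (mem_closedBall_zero_iff.1 hx)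
  have hinj : Function.Injective fun x : E ↦ a + ρ • x := fun x y h ↦
    smul_right_injective E hρ.ne' (add_left_cancel h)
  have hal : LipschitzOnWith (0 + ‖ρ‖₊) (fun x : E ↦ a + ρ • x) (closedBall 0 1) :=
    ((LipschitzWith.const a).add (lipschitzWith_smul ρ)).lipschitzOnWith
  have h := image_closedBall_mem_nhds_of_lipschitz (hl.comp hal hmaps)
    (hf.comp hinj.injOn hmaps)
  rw [image_comp] at h
  simp only [Function.comp_apply, smul_zero, add_zero] at h
  exact mem_of_superset h (image_mono hmaps.image_subset)

/-- The preimage of a ball under a Lipschitz bijection between open sets contains a ball of a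
definite size. -/
lemma ball_subset_of_lipschitzOnWith_of_injOn {f : E → E} {K : NNReal} {U : Set E}
    (hl : LipschitzOnWith K f U) (hU : IsOpen U) (hf : InjOn f U) {x : E} (hx : x ∈ U) {r d : ℝ}
    (hd : 0 < d) (hr : closedBall (f x) r ⊆ f '' U) (hdr : K * d ≤ r) : ball x d ⊆ U := by
  have hemb : Topology.IsOpenEmbedding (U.domRestrict f) :=
    .of_continuous_injective_isOpenMap hl.continuousOn.domRestrict hf.injective fun V hV ↦ by
      have hV' : IsOpen (Subtype.val '' V) := hU.isOpenMap_subtype_val V hV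
      have hVU : Subtype.val '' V ⊆ U := Subtype.coe_image_subset U V
      have := (hl.mono hVU).isOpen_image_of_injOn hV' (hf.mono hVU)
      rwa [image_image] at this
  have hC : IsCompact (Subtype.val '' (U.domRestrict f ⁻¹' closedBall (f x) r)) :=
    ((hemb.isInducing.isCompact_preimage_iff (by rwa [range_domRestrict])).2
      (isCompact_closedBall _ _)).image continuous_subtype_val
  have hsub : U ∩ ball x d ⊆ Subtype.val '' (U.domRestrict f ⁻¹' closedBall (f x) r) := by
    rintro z ⟨hzU, hz⟩
    refine ⟨⟨z, hzU⟩, ?_, rfl⟩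
    calc dist (f z) (f x) ≤ K * dist z x := hl.dist_le_mul z hzU x hx
      _ ≤ K * d := mul_le_mul_of_nonneg_left (mem_ball.1 hz).le K.2
      _ ≤ r := hdr
  have hpre : IsPreconnected (ball x d) := (convex_ball x d).isPreconnected
  refine (hpre.subset_of_closure_inter_subset (hU.inter isOpen_ball)
    ⟨x, mem_ball_self hd, hx, mem_ball_self hd⟩ fun z hz ↦ ⟨?_, hz.2⟩).trans inter_subset_left
  exact Subtype.coe_image_subset U _ (closure_minimal hsub hC.isClosed hz.1)

end Retraction
/-- pointwise convergence of inverses for uniformly Lipschitz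
bijections between bounded open sets that converge pointwise and preserve
boundaries. -/
theorem stmt_11 (n : ℕ) (Ω₁ Ω₂ : Set (EuclideanSpace ℝ (Fin n)))
    (hΩ₁o : IsOpen Ω₁) (hΩ₂o : IsOpen Ω₂)
    (hΩ₁b : Bornology.IsBounded Ω₁) (hΩ₂b : Bornology.IsBounded Ω₂)
    (F : EuclideanSpace ℝ (Fin n) → EuclideanSpace ℝ (Fin n))
    (Fj : ℕ → EuclideanSpace ℝ (Fin n) → EuclideanSpace ℝ (Fin n))
    (hmap : Set.MapsTo F (closure Ω₁) (closure Ω₂))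
    (hmapj : ∀ j, Set.MapsTo (Fj j) (closure Ω₁) (closure Ω₂))
    (hlip : ∃ K : NNReal, ∀ j, LipschitzOnWith K (Fj j) Ω₁)
    (hinj : Set.InjOn F Ω₁) (hinjj : ∀ j, Set.InjOn (Fj j) Ω₁)
    (hconv : ∀ x ∈ Ω₁, Tendsto (fun j => Fj j x) atTop (nhds (F x)))
    (hbdry : ∀ j, Fj j '' frontier Ω₁ ⊆ frontier Ω₂)
    (hontoj : ∀ j, Fj j '' Ω₁ = Ω₂) (honto : F '' Ω₁ = Ω₂) :
    ∀ y ∈ Ω₂, ∀ (xj : ℕ → EuclideanSpace ℝ (Fin n)) (x : EuclideanSpace ℝ (Fin n)),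
      (∀ j, xj j ∈ Ω₁ ∧ Fj j (xj j) = y) → x ∈ Ω₁ ∧ F x = y →
      Tendsto xj atTop (nhds x) := by
  obtain ⟨K, hK⟩ := hlip
  intro y hy xj x hxj hx
  obtain ⟨r, hr, hrΩ⟩ := Metric.nhds_basis_closedBall.mem_iff.1 (hΩ₂o.mem_nhds hy)
  have hd : 0 < r / (K + 1) := by positivity
  have hball : ∀ j, Metric.ball (xj j) (r / (K + 1)) ⊆ Ω₁ := fun j ↦ by
    refine ball_subset_of_lipschitzOnWith_of_injOn (hK j) hΩ₁o (hinjj j) (hxj j).1 (r := r) hd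
      (by rwa [(hxj j).2, hontoj j]) ?_
    rw [mul_div_assoc', div_le_iff₀ (by positivity)]
    nlinarith
  refine tendsto_of_subseq_tendsto fun ns hns ↦ ?_
  obtain ⟨a, -, φ, hφ, ha⟩ := hΩ₁b.isCompact_closure.tendsto_subseq
    fun k ↦ subset_closure (hxj (ns k)).1
  have haΩ : a ∈ Ω₁ := by
    obtain ⟨k, hk⟩ := (ha.eventually (Metric.ball_mem_nhds a hd)).exists
    exact hball _ (Metric.mem_ball_comm.1 hk)
  have hFa : Tendsto (fun k ↦ Fj (ns (φ k)) a) atTop (nhds (F a)) :=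
    (hconv a haΩ).comp (hns.comp hφ.tendsto_atTop)
  have hFy : Tendsto (fun k ↦ Fj (ns (φ k)) a) atTop (nhds y) := by
    rw [tendsto_iff_dist_tendsto_zero]
    refine squeeze_zero (fun _ ↦ dist_nonneg) (g := fun k ↦ K * dist (xj (ns (φ k))) a)
      (fun k ↦ ?_) (by simpa using (tendsto_iff_dist_tendsto_zero.1 ha).const_mul (K : ℝ))
    have := (hK (ns (φ k))).dist_le_mul a haΩ _ (hxj (ns (φ k))).1
    rwa [(hxj (ns (φ k))).2, dist_comm a] at this
  have hax : a = x := hinj haΩ hx.1 (by rw [tendsto_nhds_unique hFa hFy, hx.2])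
  exact ⟨φ, hax ▸ ha⟩
end

section
/- Assume D is lenticular (γ₁ convex and γ₂ concave on I) and ζ < (√721 − 25)/48, and let D^r = π^r(R_φ) with u^r : D^r → ℝ the locally Lipschitz function with R_φ = S^r_{u^r}. Set Δ(s) = γ₂(λ(s)) − γ₁(s) and ψ(s) = φ₂(λ(s)) − φ₁(s). Then there exist locally Lipschitz functions ω₁, ω₂ on the right cylinder V·D^r = {(s,y,t−2ys) : (y,t) ∈ D^r, s ∈ ℝ} such that: (i) ω₁² + ω₂² = 1 everywhere on V·D^r; (ii) at Lebesgue-almost every point p of V·D^r the derivatives Xω₁(p) = ∂_xω₁(p) + 2y∂_tω₁(p) and Yω₂(p) = ∂_yω₂(p) − 2x∂_tω₂(p) exist and Xω₁(p) + Yω₂(p) = 0; (iii) for every (h,s) ∈ Q, ω₁(ρ(h,s)) = Δ(s)/√(Δ(s)²+ψ(s)²) and ω₂(ρ(h,s)) = −ψ(s)/√(Δ(s)²+ψ(s)²), i.e. ω coincides on R_φ with the unit horizontal normal to R_φ pointing into the epigraph. -/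
open Set MeasureTheory

noncomputable section

/-- `Q_φ(s,λ) = λ - s + 2(γ₂(λ) - γ₁(s))(φ₂(λ) + φ₁(s))` from the paper. -/
def Qphi (γ₁ γ₂ φ₁ φ₂ : ℝ → ℝ) (s l : ℝ) : ℝ :=
  l - s + 2 * (γ₂ l - γ₁ s) * (φ₂ l + φ₁ s)

/-- The boundary curve `p(s) = (φ(s), γ(s), s + 2γ(s)φ(s))` in `ℝ³ ≅ ℍ`. -/
def heisP (γ φ : ℝ → ℝ) (s : ℝ) : ℝ × ℝ × ℝ :=
  (φ s, γ s, s + 2 * γ s * φ s)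

/-- The ruled parametrization `ρ(h,s) = (1-h)·p₁(s) + h·p₂(λ(s))`. -/
def heisRho (γ₁ γ₂ φ₁ φ₂ lam : ℝ → ℝ) (w : ℝ × ℝ) : ℝ × ℝ × ℝ :=
  (1 - w.1) • heisP γ₁ φ₁ w.2 + w.1 • heisP γ₂ φ₂ (lam w.2)

/-- The lenticular domain `D = {(y,t) : t ∈ (0,t̄), γ₁(t) < y < γ₂(t)}`. -/
def lensD (γ₁ γ₂ : ℝ → ℝ) (tb : ℝ) : Set (ℝ × ℝ) :=
  {w | w.2 ∈ Set.Ioo 0 tb ∧ γ₁ w.2 < w.1 ∧ w.1 < γ₂ w.2}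

/-- Projection onto `W = {x = 0}` along the integral curves of the right-invariant
field `X^r = ∂_x - 2y∂_t`: `π^r(x,y,t) = (y, t + 2xy)`. -/
def piR (p : ℝ × ℝ × ℝ) : ℝ × ℝ := (p.2.1, p.2.2 + 2 * p.1 * p.2.1)

/-- Slope bounds for a concave function vanishing at both ends of an interval. -/
lemma ConcaveOn.slope_bounds {g : ℝ → ℝ} {T u v : ℝ} (hg : ConcaveOn ℝ (Icc 0 T) g)
    (h0 : g 0 = 0) (hT : g T = 0) (hu : 0 < u) (huv : u ≤ v) (hv : v < T) :
    (g v - g u) * u ≤ (v - u) * g u ∧ (g u - g v) * (T - v) ≤ (v - u) * g v := by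
  have hv0 : 0 < v := hu.trans_le huv
  have huT : 0 < T - u := by linarith
  constructor
  · have h := hg.2 (show (0 : ℝ) ∈ Icc 0 T from ⟨le_rfl, by linarith⟩)
      (show v ∈ Icc 0 T from ⟨hv0.le, hv.le⟩)
      (show 0 ≤ 1 - u / v by rw [sub_nonneg, div_le_one hv0]; exact huv)
      (show 0 ≤ u / v by positivity) (by ring)
    have e : u / v * v = u := by field_simp
    simp only [smul_eq_mul, mul_zero, zero_add, h0, e] at h
    have h' := mul_le_mul_of_nonneg_right h hv0.le
    have e2 : u / v * g v * v = u * g v := by field_simp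
    nlinarith
  · have h := hg.2 (show u ∈ Icc 0 T from ⟨hu.le, by linarith⟩)
      (show T ∈ Icc 0 T from ⟨by linarith, le_rfl⟩)
      (show 0 ≤ (T - v) / (T - u) from div_nonneg (by linarith) huT.le)
      (show 0 ≤ 1 - (T - v) / (T - u) by rw [sub_nonneg, div_le_one huT]; linarith) (by ring)
    have e : (T - v) / (T - u) * u + (1 - (T - v) / (T - u)) * T = v := by field_simp; ring
    simp only [smul_eq_mul, mul_zero, add_zero, hT, e] at h
    have h' := mul_le_mul_of_nonneg_right h huT.le
    have e2 : (T - v) / (T - u) * g u * (T - u) = (T - v) * g u := by field_simp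
    nlinarith

/-- Weighted variation of a concave function `g` against values `p`, `q` controlled by the
distances of `u`, `v` to the two ends of the interval. -/
lemma ConcaveOn.weighted_variation {g : ℝ → ℝ} {T u v p q C : ℝ}
    (hg : ConcaveOn ℝ (Icc 0 T) g) (h0 : g 0 = 0) (hT : g T = 0) (hu : 0 < u) (huv : u ≤ v)
    (hv : v < T) (hC : 0 ≤ C) (hp : |p| ≤ C * u) (hq : |q| ≤ C * (T - v)) :
    |g v - g u| * |p| ≤ C * (v - u) * g u ∨ |g v - g u| * |q| ≤ C * (v - u) * g v := by
  obtain ⟨h1, h2⟩ := hg.slope_bounds h0 hT hu huv hv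
  rcases le_total 0 (g v - g u) with h | h
  · left
    rw [abs_of_nonneg h]
    nlinarith [mul_le_mul_of_nonneg_left hp h, mul_le_mul_of_nonneg_left h1 hC]
  · right
    rw [abs_of_nonpos h]
    nlinarith [mul_le_mul_of_nonneg_left hq (neg_nonneg.2 h), mul_le_mul_of_nonneg_left h2 hC]

/-- Moving the left end of `[a, b] ∋ y` changes the relative position of `y` by a controlled
amount. -/
lemma relPos_left_variation {a a' b y p q N : ℝ} (ha : a < y) (ha' : a' < y) (hb : y < b)
    (h : |a' - a| * |p| ≤ N * (b - a) ∨ |a' - a| * |q| ≤ N * (b - a')) :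
    ∃ r ∈ ({p, q} : Set ℝ), |((y - a') / (b - a') - (y - a) / (b - a)) * r| ≤ N := by
  have hA : 0 < b - a := by linarith
  have hA' : 0 < b - a' := by linarith
  have e1 : (y - a') / (b - a') - (y - a) / (b - a)
      = -((a' - a) / (b - a) * ((b - y) / (b - a'))) := by field_simp; ring
  have k : ∀ c, c < y → 0 ≤ (b - y) / (b - c) ∧ (b - y) / (b - c) ≤ 1 := fun c hc =>
    ⟨div_nonneg (by linarith) (by linarith), (div_le_one (by linarith)).2 (by linarith)⟩
  rcases h with h | h
  · refine ⟨p, by simp, ?_⟩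
    have hdiv : |a' - a| * |p| / (b - a) ≤ N := (div_le_iff₀ hA).2 h
    rw [e1, abs_mul, abs_neg, abs_mul, abs_div, abs_of_pos hA, abs_of_nonneg (k a' ha').1]
    have h0 : 0 ≤ |a' - a| * |p| / (b - a) := by positivity
    calc _ = |a' - a| * |p| / (b - a) * ((b - y) / (b - a')) := by ring
      _ ≤ |a' - a| * |p| / (b - a) := mul_le_of_le_one_right h0 (k a' ha').2
      _ ≤ N := hdiv
  · refine ⟨q, by simp, ?_⟩
    have hdiv : |a' - a| * |q| / (b - a') ≤ N := (div_le_iff₀ hA').2 h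
    have e2 : (y - a') / (b - a') - (y - a) / (b - a)
      = -((a' - a) / (b - a') * ((b - y) / (b - a))) := by rw [e1]; field_simp
    rw [e2, abs_mul, abs_neg, abs_mul, abs_div, abs_of_pos hA', abs_of_nonneg (k a ha).1]
    have h0 : 0 ≤ |a' - a| * |q| / (b - a') := by positivity
    calc _ = |a' - a| * |q| / (b - a') * ((b - y) / (b - a)) := by ring
      _ ≤ |a' - a| * |q| / (b - a') := mul_le_of_le_one_right h0 (k a ha).2
      _ ≤ N := hdiv

/-- Moving the right end of `[a, b] ∋ y` changes the relative position of `y` by a controlled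
amount. -/
lemma relPos_right_variation {a b b' y p q N : ℝ} (ha : a < y) (hb : y < b) (hb' : y < b')
    (h : |b' - b| * |p| ≤ N * (b - a) ∨ |b' - b| * |q| ≤ N * (b' - a)) :
    ∃ r ∈ ({p, q} : Set ℝ), |((y - a) / (b' - a) - (y - a) / (b - a)) * r| ≤ N := by
  obtain ⟨r, hr, h'⟩ := relPos_left_variation (a := -b) (a' := -b') (b := -a) (y := -y)
    (p := p) (q := q) (N := N) (by linarith) (by linarith) (by linarith)
    (by
      have e : |-b' - -b| = |b' - b| := by rw [abs_sub_comm]; congr 1; ring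
      rw [e]; convert h using 3 <;> ring)
  refine ⟨r, hr, ?_⟩
  rw [← abs_neg]
  convert h' using 2
  have h1 : b - a ≠ 0 := by linarith
  have h2 : b' - a ≠ 0 := by linarith
  have h3 : -a - -b ≠ 0 := by linarith
  have h4 : -a - -b' ≠ 0 := by linarith
  field_simp
  ring

/-- Variation of the value at `y` of the affine function that is `0` at `a` and `p` at `b`, when
`a`, `b` and `p` all move. -/
lemma abs_relPos_mul_sub_le {a a' b b' y p q N N' : ℝ} (ha : a < y) (ha' : a' < y) (hb : y < b)
    (hb' : y < b')
    (h : |a' - a| * |p| ≤ N * (b - a) ∨ |a' - a| * |q| ≤ N * (b - a'))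
    (h' : |b' - b| * |p| ≤ N' * (b - a') ∨ |b' - b| * |q| ≤ N' * (b' - a')) :
    |(y - a') / (b' - a') * q - (y - a) / (b - a) * p| ≤ N + N' + 2 * |q - p| := by
  obtain ⟨r, hr, h1⟩ := relPos_left_variation ha ha' hb h
  obtain ⟨r', hr', h2⟩ := relPos_right_variation ha' hb hb' h'
  have k : ∀ c d, c < y → y < d → 0 ≤ (y - c) / (d - c) ∧ (y - c) / (d - c) ≤ 1 :=
    fun c d hc hd =>
    ⟨div_nonneg (by linarith) (by linarith), (div_le_one (by linarith)).2 (by linarith)⟩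
  have k1 := k a b ha hb
  have k2 := k a' b ha' hb
  have k3 := k a' b' ha' hb'
  generalize (y - a) / (b - a) = x at *
  generalize (y - a') / (b - a') = x' at *
  generalize (y - a') / (b' - a') = x'' at *
  have key : ∃ m, |m| ≤ 2 ∧ x'' * q - x * p = (x' - x) * r + (x'' - x') * r' + m * (q - p) := by
    rcases hr with rfl | rfl <;> rcases hr' with rfl | rfl
    · exact ⟨x'', by rw [abs_le]; constructor <;> linarith, by ring⟩
    · exact ⟨x', by rw [abs_le]; constructor <;> linarith, by ring⟩
    · exact ⟨x'' - x' + x, by rw [abs_le]; constructor <;> linarith, by ring⟩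
    · exact ⟨x, by rw [abs_le]; constructor <;> linarith, by ring⟩
  obtain ⟨m, hm, e⟩ := key
  rw [e]
  have h3 : |m * (q - p)| ≤ 2 * |q - p| := by
    rw [abs_mul]; exact mul_le_mul_of_nonneg_right hm (abs_nonneg _)
  have := abs_add_three ((x' - x) * r) ((x'' - x') * r') (m * (q - p))
  linarith

/-- A product of bounded Lipschitz quantities varies in a Lipschitz way. -/
lemma abs_mul_sub_mul_le {x x' y y' A B d e : ℝ} (hx : |x| ≤ A) (hy' : |y'| ≤ B)
    (hd : |x' - x| ≤ d) (he : |y' - y| ≤ e) : |x' * y' - x * y| ≤ d * B + A * e := by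
  have e1 : x' * y' - x * y = (x' - x) * y' + x * (y' - y) := by ring
  rw [e1]
  refine (abs_add_le _ _).trans ?_
  rw [abs_mul, abs_mul]
  have := abs_nonneg (x' - x)
  have := abs_nonneg x
  have := abs_nonneg y'
  have := abs_nonneg (y' - y)
  gcongr <;> linarith

/-- Lipschitz estimate for `λ - s` along solutions of `Q_φ(s, λ(s)) = 0`. -/
lemma Qphi_solution_bounds {tb : ℝ} {γ₁ γ₂ φ₁ φ₂ lam : ℝ → ℝ} {Mγ Lγ Mφ Lφ : NNReal}
    (hγ₁lip : LipschitzOnWith Lγ γ₁ (Icc 0 tb)) (hγ₂lip : LipschitzOnWith Lγ γ₂ (Icc 0 tb))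
    (hγ₁bd : ∀ s ∈ Icc 0 tb, |γ₁ s| ≤ (Mγ : ℝ)) (hγ₂bd : ∀ s ∈ Icc 0 tb, |γ₂ s| ≤ (Mγ : ℝ))
    (hφ₁lip : LipschitzOnWith Lφ φ₁ (Icc 0 tb)) (hφ₂lip : LipschitzOnWith Lφ φ₂ (Icc 0 tb))
    (hφ₁bd : ∀ s ∈ Icc 0 tb, |φ₁ s| ≤ (Mφ : ℝ)) (hφ₂bd : ∀ s ∈ Icc 0 tb, |φ₂ s| ≤ (Mφ : ℝ))
    (hsmall : 4 * ((Lγ : ℝ) * Mφ + Mγ * Lφ) ≤ 1 / 3)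
    (hmaps : MapsTo lam (Icc 0 tb) (Icc 0 tb)) (hmono : MonotoneOn lam (Icc 0 tb))
    (hsol : ∀ s ∈ Icc 0 tb, Qphi γ₁ γ₂ φ₁ φ₂ s (lam s) = 0)
    {u v : ℝ} (hu : u ∈ Icc 0 tb) (hv : v ∈ Icc 0 tb) (huv : u ≤ v) :
    lam v - lam u ≤ 2 * (v - u) ∧ v - u ≤ 2 * (lam v - lam u) := by
  have hlu := hmaps hu
  have hlv := hmaps hv
  have hl := hmono hu hv huv
  have L : ∀ {f : ℝ → ℝ} {K : NNReal}, LipschitzOnWith K f (Icc 0 tb) →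
      ∀ {a b}, a ∈ Icc 0 tb → b ∈ Icc 0 tb → a ≤ b → |f b - f a| ≤ K * (b - a) := by
    intro f K hf a b ha hb hab
    have := hf.dist_le_mul b hb a ha
    rwa [Real.dist_eq, Real.dist_eq, abs_of_nonneg (sub_nonneg.2 hab)] at this
  have g1 := abs_le.1 (L hγ₁lip hu hv huv)
  have g2 := abs_le.1 (L hγ₂lip hlu hlv hl)
  have f1 := abs_le.1 (L hφ₁lip hu hv huv)
  have f2 := abs_le.1 (L hφ₂lip hlu hlv hl)
  have b1 := abs_le.1 (hγ₁bd u hu)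
  have b2 := abs_le.1 (hγ₂bd _ hlu)
  have b3 := abs_le.1 (hφ₁bd v hv)
  have b4 := abs_le.1 (hφ₂bd _ hlv)
  have key := abs_mul_sub_mul_le (x := γ₂ (lam u) - γ₁ u) (x' := γ₂ (lam v) - γ₁ v)
    (y := φ₂ (lam u) + φ₁ u) (y' := φ₂ (lam v) + φ₁ v) (A := 2 * Mγ) (B := 2 * Mφ)
    (d := Lγ * ((lam v - lam u) + (v - u))) (e := Lφ * ((lam v - lam u) + (v - u)))
    (by rw [abs_le]; constructor <;> linarith) (by rw [abs_le]; constructor <;> linarith)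
    (by rw [abs_le]; constructor <;> nlinarith) (by rw [abs_le]; constructor <;> nlinarith)
  have q1 := hsol u hu
  have q2 := hsol v hv
  unfold Qphi at q1 q2
  set P := (γ₂ (lam v) - γ₁ v) * (φ₂ (lam v) + φ₁ v)
    - (γ₂ (lam u) - γ₁ u) * (φ₂ (lam u) + φ₁ u) with hP
  have e : (lam v - lam u) - (v - u) = -2 * P := by rw [hP]; linarith
  have hS : 0 ≤ (lam v - lam u) + (v - u) := by linarith
  have k2 : 2 * |P| ≤ 1 / 3 * ((lam v - lam u) + (v - u)) := by
    nlinarith [mul_le_mul_of_nonneg_right hsmall hS]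
  have k3 := abs_le.1 (show |P| ≤ 1 / 6 * ((lam v - lam u) + (v - u)) by linarith)
  constructor <;> linarith

/-- At a fixed `y`, the projected rulings move forward in the `t` direction with speed bounded
below. -/
lemma ruling_height_strict_mono {tb : ℝ} {γ₁ γ₂ φ₁ φ₂ lam : ℝ → ℝ} {Mγ Lγ Mφ Lφ : NNReal}
    (hγ₁lip : LipschitzOnWith Lγ γ₁ (Icc 0 tb))
    (hγ₁bd : ∀ s ∈ Icc 0 tb, |γ₁ s| ≤ (Mγ : ℝ)) (hγ₂bd : ∀ s ∈ Icc 0 tb, |γ₂ s| ≤ (Mγ : ℝ))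
    (hφ₁lip : LipschitzOnWith Lφ φ₁ (Icc 0 tb)) (hφ₂lip : LipschitzOnWith Lφ φ₂ (Icc 0 tb))
    (hφ₁bd : ∀ s ∈ Icc 0 tb, |φ₁ s| ≤ (Mφ : ℝ)) (hφ₂bd : ∀ s ∈ Icc 0 tb, |φ₂ s| ≤ (Mφ : ℝ))
    (hsign : ∀ t ∈ Ioo 0 tb, γ₁ t < 0 ∧ 0 < γ₂ t)
    (hγ₁0 : γ₁ 0 = 0) (hγ₁t : γ₁ tb = 0) (hγ₂0 : γ₂ 0 = 0) (hγ₂t : γ₂ tb = 0)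
    (hφ0 : φ₁ 0 = φ₂ 0) (hφt : φ₁ tb = φ₂ tb)
    (hconv : ConvexOn ℝ (Icc 0 tb) γ₁) (hconc : ConcaveOn ℝ (Icc 0 tb) γ₂)
    (hsmall : 4 * ((Lγ : ℝ) * Mφ + Mγ * Lφ) ≤ 1 / 25)
    (hlam : ∀ {u v : ℝ}, u ∈ Icc 0 tb → v ∈ Icc 0 tb → u ≤ v →
      lam v - lam u ≤ 2 * (v - u) ∧ v - u ≤ 2 * (lam v - lam u))
    (hlam0 : lam 0 = 0) (hlamt : lam tb = tb)
    {u v y : ℝ} (hu : u ∈ Ioo 0 tb) (hv : v ∈ Ioo 0 tb) (huv : u ≤ v)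
    (hyu : y ∈ Ioo (γ₁ u) (γ₂ (lam u))) (hyv : y ∈ Ioo (γ₁ v) (γ₂ (lam v))) :
    1 / 4 * (v - u) ≤
      (v + 4 * γ₁ v * φ₁ v + 2 * ((y - γ₁ v) / (γ₂ (lam v) - γ₁ v) * (φ₂ (lam v) - φ₁ v))
          * (y + γ₁ v))
      - (u + 4 * γ₁ u * φ₁ u + 2 * ((y - γ₁ u) / (γ₂ (lam u) - γ₁ u) * (φ₂ (lam u) - φ₁ u))
          * (y + γ₁ u)) := by
  have htb : 0 < tb := hu.1.trans hu.2
  have i0 : (0 : ℝ) ∈ Icc 0 tb := ⟨le_rfl, htb.le⟩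
  have it : tb ∈ Icc 0 tb := ⟨htb.le, le_rfl⟩
  have iu : u ∈ Icc 0 tb := Ioo_subset_Icc_self hu
  have iv : v ∈ Icc 0 tb := Ioo_subset_Icc_self hv
  obtain ⟨l0u, l0u'⟩ := hlam i0 iu hu.1.le
  obtain ⟨l0v, l0v'⟩ := hlam i0 iv hv.1.le
  obtain ⟨lut, lut'⟩ := hlam iu it hu.2.le
  obtain ⟨lvt, lvt'⟩ := hlam iv it hv.2.le
  obtain ⟨luv, luv'⟩ := hlam iu iv huv
  rw [hlam0] at l0u l0u' l0v l0v'
  rw [hlamt] at lut lut' lvt lvt'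
  have u0 := hu.1
  have ut := hu.2
  have v0 := hv.1
  have vt := hv.2
  have jlu : lam u ∈ Ioo 0 tb := ⟨by linarith, by linarith⟩
  have jlv : lam v ∈ Ioo 0 tb := ⟨by linarith, by linarith⟩
  have ilu : lam u ∈ Icc 0 tb := Ioo_subset_Icc_self jlu
  have ilv : lam v ∈ Icc 0 tb := Ioo_subset_Icc_self jlv
  have hl : lam u ≤ lam v := by linarith
  have L : ∀ {f : ℝ → ℝ} {K : NNReal}, LipschitzOnWith K f (Icc 0 tb) →
      ∀ {a b}, a ∈ Icc 0 tb → b ∈ Icc 0 tb → a ≤ b → |f b - f a| ≤ K * (b - a) := by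
    intro f K hf a b ha hb hab
    have := hf.dist_le_mul b hb a ha
    rwa [Real.dist_eq, Real.dist_eq, abs_of_nonneg (sub_nonneg.2 hab)] at this
  have hL0 : (0 : ℝ) ≤ Lφ := Lφ.2
  -- bounds for `ψ` near the ends of the interval
  have psi0 : ∀ {s}, s ∈ Icc 0 tb → lam s ∈ Icc 0 tb →
      |φ₂ (lam s) - φ₁ s| ≤ Lφ * (lam s + s) := by
    intro s hs hls
    have a1 := abs_le.1 (L hφ₁lip i0 hs hs.1)
    have a2 := abs_le.1 (L hφ₂lip i0 hls hls.1)
    rw [abs_le]; constructor <;> linarith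
  have psit : ∀ {s}, s ∈ Icc 0 tb → lam s ∈ Icc 0 tb →
      |φ₂ (lam s) - φ₁ s| ≤ Lφ * ((tb - lam s) + (tb - s)) := by
    intro s hs hls
    have a1 := abs_le.1 (L hφ₁lip hs it hs.2)
    have a2 := abs_le.1 (L hφ₂lip hls it hls.2)
    rw [abs_le]; constructor <;> linarith
  have pu := psi0 iu ilu
  have pv := psit iv ilv
  have hpu : |φ₂ (lam u) - φ₁ u| ≤ 3 * Lφ * u ∧ |φ₂ (lam u) - φ₁ u| ≤ 3 * Lφ * lam u := by
    constructor <;> refine pu.trans ?_ <;> rw [mul_comm 3, mul_assoc] <;>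
      exact mul_le_mul_of_nonneg_left (by linarith) hL0
  have hqv : |φ₂ (lam v) - φ₁ v| ≤ 3 * Lφ * (tb - v) ∧
      |φ₂ (lam v) - φ₁ v| ≤ 3 * Lφ * (tb - lam v) := by
    constructor <;> refine pv.trans ?_ <;> rw [mul_comm 3, mul_assoc] <;>
      exact mul_le_mul_of_nonneg_left (by linarith) hL0
  have hp : |φ₂ (lam v) - φ₁ v - (φ₂ (lam u) - φ₁ u)| ≤ 3 * Lφ * (v - u) := by
    have a1 := abs_le.1 (L hφ₁lip iu iv huv)
    have a2 := abs_le.1 (L hφ₂lip ilu ilv hl)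
    have a3 := mul_le_mul_of_nonneg_left luv hL0
    rw [abs_le]; constructor <;> linarith
  have hN : |γ₁ v - γ₁ u| * |φ₂ (lam u) - φ₁ u| ≤ (3 * Lφ * (v - u)) * (γ₂ (lam u) - γ₁ u) ∨
      |γ₁ v - γ₁ u| * |φ₂ (lam v) - φ₁ v| ≤ (3 * Lφ * (v - u)) * (γ₂ (lam u) - γ₁ v) := by
    have h := hconv.neg.weighted_variation (u := u) (v := v) (p := φ₂ (lam u) - φ₁ u)
      (q := φ₂ (lam v) - φ₁ v) (C := 3 * Lφ) (by simp [hγ₁0]) (by simp [hγ₁t]) hu.1 huv hv.2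
      (by positivity) hpu.1 hqv.1
    simp only [Pi.neg_apply] at h
    have e : |-γ₁ v - -γ₁ u| = |γ₁ v - γ₁ u| := by rw [← abs_neg]; congr 1; ring
    rw [e] at h
    have c0 : 0 ≤ 3 * Lφ * (v - u) * γ₂ (lam u) :=
      mul_nonneg (mul_nonneg (by positivity) (by linarith)) (hsign _ jlu).2.le
    rcases h with h | h
    · left; linarith
    · right; linarith
  have hN' : |γ₂ (lam v) - γ₂ (lam u)| * |φ₂ (lam u) - φ₁ u|
        ≤ (6 * Lφ * (v - u)) * (γ₂ (lam u) - γ₁ v) ∨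
      |γ₂ (lam v) - γ₂ (lam u)| * |φ₂ (lam v) - φ₁ v|
        ≤ (6 * Lφ * (v - u)) * (γ₂ (lam v) - γ₁ v) := by
    have h := hconc.weighted_variation (u := lam u) (v := lam v) (p := φ₂ (lam u) - φ₁ u)
      (q := φ₂ (lam v) - φ₁ v) (C := 3 * Lφ) hγ₂0 hγ₂t jlu.1 hl jlv.2
      (by positivity) hpu.2 hqv.2
    have c0 : 0 ≤ 6 * Lφ * (v - u) * -γ₁ v :=
      mul_nonneg (mul_nonneg (by positivity) (by linarith)) (neg_nonneg.2 (hsign _ hv).1.le)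
    have c1 : 3 * (Lφ : ℝ) * (lam v - lam u) ≤ 6 * Lφ * (v - u) := by
      have := mul_le_mul_of_nonneg_left luv (by positivity : 0 ≤ 3 * (Lφ : ℝ))
      linarith
    rcases h with h | h
    · left; linarith [mul_le_mul_of_nonneg_right c1 (hsign _ jlu).2.le]
    · right; linarith [mul_le_mul_of_nonneg_right c1 (hsign _ jlv).2.le]
  have hb := abs_relPos_mul_sub_le hyu.1 hyv.1 hyu.2 hyv.2 hN hN'
  have hbu : |(y - γ₁ u) / (γ₂ (lam u) - γ₁ u) * (φ₂ (lam u) - φ₁ u)| ≤ 2 * Mφ := by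
    have hd : 0 < γ₂ (lam u) - γ₁ u := by linarith [hyu.1, hyu.2]
    rw [abs_mul, abs_of_nonneg (div_nonneg (by linarith [hyu.1]) hd.le)]
    have a1 := abs_le.1 (hφ₁bd u iu)
    have a2 := abs_le.1 (hφ₂bd _ ilu)
    have a3 : |φ₂ (lam u) - φ₁ u| ≤ 2 * Mφ := by rw [abs_le]; constructor <;> linarith
    exact (mul_le_of_le_one_left (abs_nonneg _)
      ((div_le_one hd).2 (by linarith [hyu.2]))).trans a3
  generalize (y - γ₁ u) / (γ₂ (lam u) - γ₁ u) * (φ₂ (lam u) - φ₁ u) = b at *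
  generalize (y - γ₁ v) / (γ₂ (lam v) - γ₁ v) * (φ₂ (lam v) - φ₁ v) = b' at *
  have hM1 := abs_le.1 (hγ₁bd u iu)
  have hM1' := abs_le.1 (hγ₁bd v iv)
  have hM2 := abs_le.1 (hγ₂bd _ ilu)
  have k1 := abs_mul_sub_mul_le (hγ₁bd u iu) (hφ₁bd v iv) (L hγ₁lip iu iv huv)
    (L hφ₁lip iu iv huv)
  have k2 := abs_mul_sub_mul_le (x := b) (x' := b') (y := y + γ₁ u) (y' := y + γ₁ v)
    (A := 2 * Mφ) (B := 2 * Mγ) (d := 15 * Lφ * (v - u)) (e := Lγ * (v - u)) hbu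
    (by rw [abs_le]; constructor <;> linarith [hyu.1, hyu.2]) (by linarith)
    (by have := L hγ₁lip iu iv huv; simpa using this)
  have k3 := (abs_le.1 k1).1
  have k4 := (abs_le.1 k2).1
  have hd : 0 ≤ v - u := by linarith
  have n1 : 0 ≤ (Lγ : ℝ) * Mφ * (v - u) := by positivity
  have n2 : 0 ≤ (Mγ : ℝ) * Lφ * (v - u) := by positivity
  linarith [mul_le_mul_of_nonneg_right hsmall hd]

open Filter Topology in
/-- A `C¹` function of a locally Lipschitz function is locally Lipschitz. -/
lemma LocallyLipschitzOn.contDiffAt_comp {X E F : Type*} [PseudoMetricSpace X]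
    [NormedAddCommGroup E] [NormedSpace ℝ E] [NormedAddCommGroup F] [NormedSpace ℝ F]
    {S : Set X} {f : X → E} {g : E → F} (hf : LocallyLipschitzOn S f)
    (hg : ∀ x ∈ S, ContDiffAt ℝ 1 g (f x)) : LocallyLipschitzOn S (g ∘ f) := by
  intro x hx
  obtain ⟨K, t, ht, hK⟩ := hf hx
  obtain ⟨K', t', ht', hK'⟩ := (hg x hx).exists_lipschitzOnWith
  refine ⟨K' * K, t ∩ f ⁻¹' t', inter_mem ht (hf.continuousOn x hx ht'), ?_⟩
  exact hK'.comp (hK.mono inter_subset_left) fun y hy => hy.2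

open Filter Topology in
/-- Composition of locally Lipschitz functions. -/
lemma LocallyLipschitzOn.comp_mapsTo {X Y Z : Type*} [PseudoMetricSpace X] [PseudoMetricSpace Y]
    [PseudoMetricSpace Z] {S : Set X} {T : Set Y} {f : X → Y} {g : Y → Z}
    (hg : LocallyLipschitzOn T g) (hf : LocallyLipschitzOn S f) (hST : MapsTo f S T) :
    LocallyLipschitzOn S (g ∘ f) := by
  intro x hx
  obtain ⟨K, t, ht, hK⟩ := hf hx
  obtain ⟨K', t', ht', hK'⟩ := hg (hST hx)
  refine ⟨K' * K, t ∩ f ⁻¹' t', inter_mem ht ?_, ?_⟩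
  · exact (hf.continuousOn x hx).tendsto_nhdsWithin hST ht'
  · exact hK'.comp (hK.mono inter_subset_left) fun y hy => hy.2

open Filter Topology in
/-- Rademacher's theorem for locally Lipschitz functions on open sets. -/
lemma LocallyLipschitzOn.ae_differentiableAt {E : Type*} [NormedAddCommGroup E] [NormedSpace ℝ E]
    [FiniteDimensional ℝ E] [MeasurableSpace E] [BorelSpace E] {μ : Measure E}
    [μ.IsAddHaarMeasure] {S : Set E} {f : E → ℝ} (hS : IsOpen S) (hf : LocallyLipschitzOn S f) :
    ∀ᵐ x ∂(μ.restrict S), DifferentiableAt ℝ f x := by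
  rw [ae_restrict_iff' hS.measurableSet, ae_iff]
  refine measure_null_of_locally_null _ fun x hx => ?_
  have hxS : x ∈ S := by
    by_contra h
    exact hx fun h' => absurd h' h
  obtain ⟨K, t, ht, hK⟩ := hf hxS
  rw [hS.nhdsWithin_eq hxS] at ht
  have h := (hK.mono (interior_subset (s := t))).ae_differentiableWithinAt_of_mem (μ := μ)
  refine ⟨interior t ∩ {y | ¬ (y ∈ S → DifferentiableAt ℝ f y)}, ?_, ?_⟩
  · exact inter_mem (mem_nhdsWithin_of_mem_nhds (interior_mem_nhds.2 ht)) self_mem_nhdsWithin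
  · refine measure_mono_null ?_ (ae_iff.1 h)
    rintro y ⟨hy, hy'⟩ hc
    exact hy' fun _ => (hc hy).differentiableAt (isOpen_interior.mem_nhds hy)

open Filter Topology in
/-- A family of parabolas `t = c(s) + 2 a(s) y²`, `A(s) < y < B(s)`, whose heights increase with
`s` at a definite rate foliates an open set, and the parameter `a` is locally Lipschitz there. -/
lemma exists_locallyLipschitzOn_parabola_parameter {T κ : ℝ} {A B a c : ℝ → ℝ} (hκ : 0 < κ)
    (hA : ContinuousOn A (Ioo 0 T)) (hB : ContinuousOn B (Ioo 0 T))
    (ha : LocallyLipschitzOn (Ioo 0 T) a) (hc : ContinuousOn c (Ioo 0 T))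
    (hmono : ∀ u ∈ Ioo 0 T, ∀ v ∈ Ioo 0 T, u ≤ v → ∀ y ∈ Ioo (A u) (B u), y ∈ Ioo (A v) (B v) →
      κ * (v - u) ≤ (c v + 2 * a v * y ^ 2) - (c u + 2 * a u * y ^ 2))
    {D : Set (ℝ × ℝ)}
    (hD : ∀ w, w ∈ D ↔ ∃ s ∈ Ioo 0 T, w.1 ∈ Ioo (A s) (B s) ∧ w.2 = c s + 2 * a s * w.1 ^ 2) :
    IsOpen D ∧ ∃ α : ℝ × ℝ → ℝ,
      (∀ s ∈ Ioo 0 T, ∀ y ∈ Ioo (A s) (B s), α (y, c s + 2 * a s * y ^ 2) = a s) ∧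
      LocallyLipschitzOn D α := by
  have hdist : ∀ u ∈ Ioo 0 T, ∀ v ∈ Ioo 0 T, ∀ y ∈ Ioo (A u) (B u), y ∈ Ioo (A v) (B v) →
      κ * |v - u| ≤ |(c v + 2 * a v * y ^ 2) - (c u + 2 * a u * y ^ 2)| := by
    intro u hu v hv y hyu hyv
    rcases le_total u v with h | h
    · rw [abs_of_nonneg (sub_nonneg.2 h)]
      exact (hmono u hu v hv h y hyu hyv).trans (le_abs_self _)
    · rw [abs_sub_comm, abs_of_nonneg (sub_nonneg.2 h), abs_sub_comm]
      exact (hmono v hv u hu h y hyv hyu).trans (le_abs_self _)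
  have hex : ∀ w : ℝ × ℝ, ∃ r : ℝ, ∀ s ∈ Ioo 0 T, w.1 ∈ Ioo (A s) (B s) →
      w.2 = c s + 2 * a s * w.1 ^ 2 → r = a s := by
    intro w
    by_cases hw : w ∈ D
    · obtain ⟨s, hs, hy, h⟩ := (hD w).1 hw
      refine ⟨a s, fun s' hs' hy' h' => ?_⟩
      have := hdist s hs s' hs' _ hy hy'
      rw [← h, ← h', sub_self, abs_zero] at this
      have h0 : |s' - s| ≤ 0 := by
        by_contra hlt
        have := mul_pos hκ (not_le.1 hlt)
        linarith
      have : s' = s := by linarith [abs_nonpos_iff.1 h0]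
      rw [this]
    · exact ⟨0, fun s hs hy h => absurd ((hD w).2 ⟨s, hs, hy, h⟩) hw⟩
  choose α hα using hex
  -- near each point of `D` the leaf parameter stays in a compact interval
  have hloc : ∀ w ∈ D, ∃ S : Set ℝ, ∃ η > (0 : ℝ), ∃ K : NNReal, ∃ M : ℝ,
      LipschitzOnWith K a S ∧ S ⊆ Ioo 0 T ∧
      (∀ s ∈ S, |a s| ≤ M) ∧ (∀ s ∈ S, ∀ y ∈ Metric.ball w.1 η, y ∈ Ioo (A s) (B s)) ∧
      ∀ᶠ z in 𝓝 w, z.1 ∈ Metric.ball w.1 η ∧ ∃ s ∈ S, z.2 = c s + 2 * a s * z.1 ^ 2 := by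
    intro w hw
    obtain ⟨s₀, hs₀, hy₀, hw₀⟩ := (hD w).1 hw
    have hn : Ioo 0 T ∈ 𝓝 s₀ := isOpen_Ioo.mem_nhds hs₀
    obtain ⟨K, t, ht, hK⟩ := ha hs₀
    rw [isOpen_Ioo.nhdsWithin_eq hs₀] at ht
    obtain ⟨m₁, hm₁, hm₁'⟩ := exists_between hy₀.1
    obtain ⟨m₂, hm₂, hm₂'⟩ := exists_between hy₀.2
    have eA : ∀ᶠ s in 𝓝 s₀, A s < m₁ := (hA.continuousAt hn).eventually (gt_mem_nhds hm₁)
    have eB : ∀ᶠ s in 𝓝 s₀, m₂ < B s := (hB.continuousAt hn).eventually (lt_mem_nhds hm₂')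
    have ea : ∀ᶠ s in 𝓝 s₀, |a s| < |a s₀| + 1 :=
      ((ha.continuousOn.continuousAt hn).abs).eventually (gt_mem_nhds (by linarith))
    obtain ⟨ε, hε, hball⟩ := Metric.nhds_basis_closedBall.mem_iff.1
      (eA.and (eB.and (ea.and ((eventually_mem_set.2 hn).and (eventually_mem_set.2 ht)))))
    rw [Real.closedBall_eq_Icc] at hball
    have hl : s₀ - ε ∈ Icc (s₀ - ε) (s₀ + ε) := ⟨le_rfl, by linarith⟩
    have hr : s₀ + ε ∈ Icc (s₀ - ε) (s₀ + ε) := ⟨by linarith, le_rfl⟩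
    have hSy : ∀ s ∈ Icc (s₀ - ε) (s₀ + ε), ∀ y ∈ Metric.ball w.1 (min (w.1 - m₁) (m₂ - w.1)),
        y ∈ Ioo (A s) (B s) := by
      intro s hs y hy
      obtain ⟨h1, h2, -⟩ := hball hs
      rw [Metric.mem_ball, Real.dist_eq, lt_min_iff] at hy
      have h3 := abs_lt.1 hy.1
      have h4 := abs_lt.1 hy.2
      constructor <;> linarith
    have hη : 0 < min (w.1 - m₁) (m₂ - w.1) := lt_min (by linarith) (by linarith)
    have hw1 := Metric.mem_ball_self (x := w.1) hη
    have hS : Icc (s₀ - ε) (s₀ + ε) ⊆ Ioo 0 T := fun s hs => (hball hs).2.2.2.1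
    refine ⟨Icc (s₀ - ε) (s₀ + ε), _, hη, K, |a s₀| + 1,
      hK.mono fun s hs => (hball hs).2.2.2.2, hS, fun s hs => (hball hs).2.2.1.le, hSy, ?_⟩
    have hlt₁ := hmono _ (hS hl) _ hs₀ (by linarith) _ (hSy _ hl _ hw1) hy₀
    have hlt₂ := hmono _ hs₀ _ (hS hr) (by linarith) _ hy₀ (hSy _ hr _ hw1)
    rw [← hw₀] at hlt₁ hlt₂
    have hκε : 0 < κ * ε := mul_pos hκ hε
    have e₁ : ∀ᶠ z : ℝ × ℝ in 𝓝 w, c (s₀ - ε) + 2 * a (s₀ - ε) * z.1 ^ 2 < z.2 :=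
      ContinuousAt.eventually_lt (by fun_prop) (by fun_prop) (by linarith)
    have e₂ : ∀ᶠ z : ℝ × ℝ in 𝓝 w, z.2 < c (s₀ + ε) + 2 * a (s₀ + ε) * z.1 ^ 2 :=
      ContinuousAt.eventually_lt (by fun_prop) (by fun_prop) (by linarith)
    have e₃ : ∀ᶠ z : ℝ × ℝ in 𝓝 w, z.1 ∈ Metric.ball w.1 (min (w.1 - m₁) (m₂ - w.1)) :=
      continuousAt_fst.eventually (Metric.ball_mem_nhds _ hη)
    filter_upwards [e₁, e₂, e₃] with z h₁ h₂ h₃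
    have hcont : ContinuousOn (fun s => c s + 2 * a s * z.1 ^ 2) (Icc (s₀ - ε) (s₀ + ε)) :=
      (hc.mono hS).add (((ha.continuousOn.mono hS).const_smul (2 : ℝ)).mul continuousOn_const)
    obtain ⟨s, hs, h⟩ := intermediate_value_Icc (by linarith) hcont ⟨h₁.le, h₂.le⟩
    exact ⟨h₃, s, hs, h.symm⟩
  refine ⟨isOpen_iff_mem_nhds.2 fun w hw => ?_, α, fun s hs y hy => hα (y, _) s hs hy rfl, ?_⟩
  · obtain ⟨S, η, hη, K, M, hK, hS, hM, hSy, hev⟩ := hloc w hw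
    filter_upwards [hev] with z ⟨hz, s, hs, h⟩
    exact (hD z).2 ⟨s, hS hs, hSy s hs _ hz, h⟩
  · intro w hw
    obtain ⟨S, η, hη, K, M, hK, hS, hM, hSy, hev⟩ := hloc w hw
    have hC : 0 ≤ K * ((1 + 2 * |M| * (2 * (|w.1| + η))) / κ) := by positivity
    refine ⟨⟨_, hC⟩, _, mem_nhdsWithin_of_mem_nhds hev, LipschitzOnWith.of_dist_le_mul ?_⟩
    rintro z ⟨hz, s, hs, h⟩ z' ⟨hz', s', hs', h'⟩
    rw [hα z s (hS hs) (hSy s hs _ hz) h, hα z' s' (hS hs') (hSy s' hs' _ hz') h']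
    refine (hK.dist_le_mul s hs s' hs').trans ?_
    show _ ≤ K * ((1 + 2 * |M| * (2 * (|w.1| + η))) / κ) * dist z z'
    rw [mul_assoc]
    refine mul_le_mul_of_nonneg_left ?_ K.2
    rw [div_mul_eq_mul_div, le_div_iff₀ hκ, mul_comm, Real.dist_eq]
    refine (hdist s' (hS hs') s (hS hs) z.1 (hSy s' hs' _ hz) (hSy s hs _ hz)).trans ?_
    have e : (c s + 2 * a s * z.1 ^ 2) - (c s' + 2 * a s' * z.1 ^ 2)
        = (z.2 - z'.2) + 2 * a s' * (z'.1 + z.1) * (z'.1 - z.1) := by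
      rw [h, h']; ring
    have d1 : |z'.1 - z.1| ≤ dist z z' := by
      rw [abs_sub_comm, ← Real.dist_eq, Prod.dist_eq]; exact le_max_left _ _
    have d2 : |z.2 - z'.2| ≤ dist z z' := by
      rw [← Real.dist_eq, Prod.dist_eq]; exact le_max_right _ _
    rw [Metric.mem_ball, Real.dist_eq] at hz hz'
    have d3 : |z'.1 + z.1| ≤ 2 * (|w.1| + η) := by
      have e' : z'.1 + z.1 = (z'.1 - w.1) + (z.1 - w.1) + 2 * w.1 := by ring
      rw [e']
      have := abs_add_three (z'.1 - w.1) (z.1 - w.1) (2 * w.1)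
      rw [abs_mul 2, abs_two] at this
      linarith
    rw [e, add_mul, one_mul]
    refine (abs_add_le _ _).trans (add_le_add d2 ?_)
    rw [abs_mul, abs_mul, abs_mul, abs_two]
    have := (hM s' hs').trans (le_abs_self M)
    gcongr

/-- If `α` is differentiable at `p`
with zero derivative along the horizontal direction `(α p, 1)`, the unit horizontal field
`(1, -α)/√(1+α²)` has zero horizontal divergence at `p`. -/
lemma horizontal_divergence_eq_zero {α : ℝ × ℝ × ℝ → ℝ} {p : ℝ × ℝ × ℝ}
    (hd : DifferentiableAt ℝ α p)
    (hline : HasLineDerivAt ℝ α 0 p (α p, 1, 2 * p.2.1 * α p - 2 * p.1)) :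
    ∃ a b : ℝ,
      HasLineDerivAt ℝ (fun q => 1 / √(1 + α q ^ 2)) a p (1, 0, 2 * p.2.1) ∧
      HasLineDerivAt ℝ (fun q => -α q / √(1 + α q ^ 2)) b p (0, 1, -(2 * p.1)) ∧ a + b = 0 := by
  set L := fderiv ℝ α p with hL
  have h0 : L (α p, 1, 2 * p.2.1 * α p - 2 * p.1) = 0 :=
    (hd.hasFDerivAt.hasLineDerivAt _).unique hline
  have e : ((α p, 1, 2 * p.2.1 * α p - 2 * p.1) : ℝ × ℝ × ℝ)
      = α p • (1, 0, 2 * p.2.1) + (0, 1, -(2 * p.1)) := by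
    ext <;> simp
    ring
  rw [e, map_add, map_smul, smul_eq_mul] at h0
  have hpos : 0 < 1 + α p ^ 2 := by positivity
  have hs : 0 < √(1 + α p ^ 2) := Real.sqrt_pos.2 hpos
  have hsq : √(1 + α p ^ 2) ^ 2 = 1 + α p ^ 2 := Real.sq_sqrt hpos.le
  have key : ∀ v : ℝ × ℝ × ℝ,
      HasLineDerivAt ℝ (fun q => 1 / √(1 + α q ^ 2)) (-(α p * L v) / √(1 + α p ^ 2) ^ 3) p v ∧
      HasLineDerivAt ℝ (fun q => -α q / √(1 + α q ^ 2)) (-L v / √(1 + α p ^ 2) ^ 3) p v := by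
    intro v
    have hl : HasDerivAt (fun t : ℝ => α (p + t • v)) (L v) 0 :=
      hd.hasFDerivAt.hasLineDerivAt v
    have hr := ((hl.pow 2).const_add 1).sqrt (by simpa using hpos.ne')
    constructor
    · have h := (hasDerivAt_const (0 : ℝ) (1 : ℝ)).div hr (by simpa using hs.ne')
      refine h.congr_deriv ?_
      simp only [Pi.pow_apply, zero_smul, add_zero, Nat.cast_ofNat]
      field_simp
      ring
    · have h := hl.neg.div hr (by simpa using hs.ne')
      refine h.congr_deriv ?_
      simp only [Pi.pow_apply, Pi.neg_apply, zero_smul, add_zero, Nat.cast_ofNat]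
      field_simp
      rw [hsq]; ring
  refine ⟨_, _, (key _).1, (key _).2, ?_⟩
  rw [← add_div, div_eq_zero_iff]
  left; linarith

lemma contDiff_piR : ContDiff ℝ 1 piR := by
  unfold piR
  fun_prop

/-- The projection of a ruling, written as a parabola in `y = γ₁ + h (γ₂ - γ₁)`. -/
lemma piR_heisRho {γ₁ γ₂ φ₁ φ₂ lam : ℝ → ℝ} {h s : ℝ}
    (hsol : Qphi γ₁ γ₂ φ₁ φ₂ s (lam s) = 0) (hne : γ₂ (lam s) - γ₁ s ≠ 0) :
    piR (heisRho γ₁ γ₂ φ₁ φ₂ lam (h, s)) =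
      (γ₁ s + h * (γ₂ (lam s) - γ₁ s),
        (s + 4 * γ₁ s * φ₁ s
          - 2 * ((φ₂ (lam s) - φ₁ s) / (γ₂ (lam s) - γ₁ s)) * γ₁ s ^ 2)
        + 2 * ((φ₂ (lam s) - φ₁ s) / (γ₂ (lam s) - γ₁ s))
          * (γ₁ s + h * (γ₂ (lam s) - γ₁ s)) ^ 2) := by
  unfold Qphi at hsol
  have e : (φ₂ (lam s) - φ₁ s) / (γ₂ (lam s) - γ₁ s) * (γ₂ (lam s) - γ₁ s)
      = φ₂ (lam s) - φ₁ s := div_mul_cancel₀ _ hne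
  generalize (φ₂ (lam s) - φ₁ s) / (γ₂ (lam s) - γ₁ s) = a at *
  simp only [piR, heisRho, heisP, Prod.smul_mk, Prod.mk_add_mk, smul_eq_mul, Prod.mk.injEq]
  refine ⟨by ring, ?_⟩
  linear_combination h * hsol - (4 * γ₁ s * h + 2 * h ^ 2 * (γ₂ (lam s) - γ₁ s)) * e

open Filter Topology in
/-- A function that is constant along the parabola `t = c + 2 a y²` in `W`, with value `a`, has,
after composition with `π^r`, zero derivative along the horizontal direction `(a, 1)`. -/
lemma hasLineDerivAt_comp_piR {α : ℝ × ℝ → ℝ} {a c : ℝ} {I : Set ℝ} (hI : IsOpen I)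
    (hα : ∀ y ∈ I, α (y, c + 2 * a * y ^ 2) = a) {p : ℝ × ℝ × ℝ} (hp : p.2.1 ∈ I)
    (hp' : piR p = (p.2.1, c + 2 * a * p.2.1 ^ 2)) :
    HasLineDerivAt ℝ (α ∘ piR) 0 p (a, 1, 2 * p.2.1 * a - 2 * p.1) := by
  have hev : ∀ᶠ r in 𝓝 (0 : ℝ),
      (α ∘ piR) (p + r • (a, 1, 2 * p.2.1 * a - 2 * p.1)) = a := by
    have : ∀ᶠ r in 𝓝 (0 : ℝ), p.2.1 + r ∈ I :=
      ContinuousAt.eventually_mem (f := fun r : ℝ => p.2.1 + r) (by fun_prop)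
        (by simpa using hI.mem_nhds hp)
    filter_upwards [this] with r hr
    refine Eq.trans (congrArg α ?_) (hα _ hr)
    have h2 := congrArg Prod.snd hp'
    simp only [piR] at h2
    ext
    · simp [piR]
    · simp only [piR, Prod.fst_add, Prod.snd_add, Prod.smul_fst, Prod.smul_snd, smul_eq_mul]
      linear_combination h2
  exact (hasDerivAt_const (0 : ℝ) a).congr_of_eventuallyEq hev

/-- Two locally Lipschitz functions share a Lipschitz constant on small balls. -/
lemma LocallyLipschitzOn.exists_ball {X : Type*} [PseudoMetricSpace X] {S : Set X} {f g : X → ℝ}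
    (hf : LocallyLipschitzOn S f) (hg : LocallyLipschitzOn S g) {p : X} (hp : p ∈ S) :
    ∃ ε > (0 : ℝ), ∃ K : NNReal, LipschitzOnWith K f (Metric.ball p ε ∩ S) ∧
      LipschitzOnWith K g (Metric.ball p ε ∩ S) := by
  obtain ⟨K, t, ht, hK⟩ := hf hp
  obtain ⟨K', t', ht', hK'⟩ := hg hp
  obtain ⟨ε, hε, h⟩ := Metric.mem_nhdsWithin_iff.1 (Filter.inter_mem ht ht')
  exact ⟨ε, hε, max K K', (hK.mono (h.trans inter_subset_left)).weaken (le_max_left _ _),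
    (hK'.mono (h.trans inter_subset_right)).weaken (le_max_right _ _)⟩

/-- calibration of the ruled surface `R_φ` in the right cylinder
`V·D^r`: a unit horizontal section `ω = (ω₁, ω₂)`, locally Lipschitz, with vanishing
horizontal divergence a.e., agreeing on `R_φ` with the inner unit horizontal normal. -/
theorem stmt_14 (tb : ℝ) (htb : 0 < tb)
    (γ₁ γ₂ φ₁ φ₂ : ℝ → ℝ) (Mγ Lγ Mφ Lφ : NNReal)
    (hγ₁lip : LipschitzOnWith Lγ γ₁ (Set.Icc 0 tb))
    (hγ₂lip : LipschitzOnWith Lγ γ₂ (Set.Icc 0 tb))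
    (hγ₁bd : ∀ s ∈ Set.Icc 0 tb, |γ₁ s| ≤ (Mγ : ℝ))
    (hγ₂bd : ∀ s ∈ Set.Icc 0 tb, |γ₂ s| ≤ (Mγ : ℝ))
    (hφ₁lip : LipschitzOnWith Lφ φ₁ (Set.Icc 0 tb))
    (hφ₂lip : LipschitzOnWith Lφ φ₂ (Set.Icc 0 tb))
    (hφ₁bd : ∀ s ∈ Set.Icc 0 tb, |φ₁ s| ≤ (Mφ : ℝ))
    (hφ₂bd : ∀ s ∈ Set.Icc 0 tb, |φ₂ s| ≤ (Mφ : ℝ))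
    (hsign : ∀ t ∈ Set.Ioo 0 tb, γ₁ t < 0 ∧ 0 < γ₂ t)
    (hγ₁0 : γ₁ 0 = 0) (hγ₁t : γ₁ tb = 0) (hγ₂0 : γ₂ 0 = 0) (hγ₂t : γ₂ tb = 0)
    (hφ0 : φ₁ 0 = φ₂ 0) (hφt : φ₁ tb = φ₂ tb)
    (hconv : ConvexOn ℝ (Set.Icc 0 tb) γ₁)
    (hconc : ConcaveOn ℝ (Set.Icc 0 tb) γ₂)
    (zeta : ℝ) (hzdef : zeta = 4 * ((Mγ : ℝ) + (Lγ : ℝ)) * ((Mφ : ℝ) + (Lφ : ℝ)))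
    (hzeta : zeta < (Real.sqrt 721 - 25) / 48)
    (lam : ℝ → ℝ)
    (hlam_bij : Set.BijOn lam (Set.Icc 0 tb) (Set.Icc 0 tb))
    (hlam_mono : StrictMonoOn lam (Set.Icc 0 tb))
    (hlam_sol : ∀ s ∈ Set.Icc 0 tb, Qphi γ₁ γ₂ φ₁ φ₂ s (lam s) = 0)
    (hlam0 : lam 0 = 0) (hlamt : lam tb = tb)
    -- D^r and the right graph function u^r
    (Dr : Set (ℝ × ℝ)) (ur : ℝ × ℝ → ℝ)
    (hDr : Dr = piR '' (heisRho γ₁ γ₂ φ₁ φ₂ lam '' (Set.Ioo (0:ℝ) 1 ×ˢ Set.Ioo (0:ℝ) tb)))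
    (hur_lip : ∀ w ∈ Dr, ∃ ε > (0:ℝ), ∃ K : NNReal,
      LipschitzOnWith K ur (Metric.ball w ε ∩ Dr))
    (hur_graph : heisRho γ₁ γ₂ φ₁ φ₂ lam '' (Set.Ioo (0:ℝ) 1 ×ˢ Set.Ioo (0:ℝ) tb)
      = (fun w : ℝ × ℝ => (ur w, w.1, w.2 - 2 * w.1 * ur w)) '' Dr) :
    ∃ ω₁ ω₂ : ℝ × ℝ × ℝ → ℝ,
      -- locally Lipschitz on the right cylinder V·D^r = (π^r)⁻¹(D^r)
      (∀ p ∈ {q : ℝ × ℝ × ℝ | piR q ∈ Dr}, ∃ ε > (0:ℝ), ∃ K : NNReal,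
        LipschitzOnWith K ω₁ (Metric.ball p ε ∩ {q : ℝ × ℝ × ℝ | piR q ∈ Dr}) ∧
        LipschitzOnWith K ω₂ (Metric.ball p ε ∩ {q : ℝ × ℝ × ℝ | piR q ∈ Dr})) ∧
      -- (i) unit length
      (∀ p ∈ {q : ℝ × ℝ × ℝ | piR q ∈ Dr}, (ω₁ p) ^ 2 + (ω₂ p) ^ 2 = 1) ∧
      -- (ii) vanishing horizontal divergence a.e. in V·D^r
      (∀ᵐ p ∂(volume.restrict {q : ℝ × ℝ × ℝ | piR q ∈ Dr}), ∃ a b : ℝ,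
        HasLineDerivAt ℝ ω₁ a p (1, 0, 2 * p.2.1) ∧
        HasLineDerivAt ℝ ω₂ b p (0, 1, -(2 * p.1)) ∧
        a + b = 0) ∧
      -- (iii) ω is the inner unit horizontal normal on R_φ
      (∀ h ∈ Set.Ioo (0:ℝ) 1, ∀ s ∈ Set.Ioo 0 tb,
        ω₁ (heisRho γ₁ γ₂ φ₁ φ₂ lam (h, s))
          = (γ₂ (lam s) - γ₁ s) /
              Real.sqrt ((γ₂ (lam s) - γ₁ s) ^ 2 + (φ₂ (lam s) - φ₁ s) ^ 2) ∧
        ω₂ (heisRho γ₁ γ₂ φ₁ φ₂ lam (h, s))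
          = -(φ₂ (lam s) - φ₁ s) /
              Real.sqrt ((γ₂ (lam s) - γ₁ s) ^ 2 + (φ₂ (lam s) - φ₁ s) ^ 2)) := by
  have hL : (0 : ℝ) ≤ Lγ := Lγ.2
  have hM : (0 : ℝ) ≤ Mγ := Mγ.2
  have hL' : (0 : ℝ) ≤ Lφ := Lφ.2
  have hM' : (0 : ℝ) ≤ Mφ := Mφ.2
  have hsmall : 4 * ((Lγ : ℝ) * Mφ + Mγ * Lφ) ≤ 1 / 25 := by
    have h1 : √721 ≤ 26.86 := Real.sqrt_le_iff.2 ⟨by norm_num, by norm_num⟩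
    have h2 := mul_nonneg hL hL'
    have h3 := mul_nonneg hM hM'
    linarith
  have hlam : ∀ {u v : ℝ}, u ∈ Icc 0 tb → v ∈ Icc 0 tb → u ≤ v →
      lam v - lam u ≤ 2 * (v - u) ∧ v - u ≤ 2 * (lam v - lam u) := fun hu hv huv =>
    Qphi_solution_bounds hγ₁lip hγ₂lip hγ₁bd hγ₂bd hφ₁lip hφ₂lip hφ₁bd hφ₂bd (by linarith)
      hlam_bij.mapsTo hlam_mono.monotoneOn hlam_sol hu hv huv
  have hlamlip : LipschitzOnWith 2 lam (Icc 0 tb) := by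
    refine LipschitzOnWith.of_dist_le_mul fun x hx y hy => ?_
    rw [Real.dist_eq, Real.dist_eq]
    rcases le_total x y with h | h
    · have := hlam_mono.monotoneOn hx hy h
      rw [abs_sub_comm, abs_sub_comm x, abs_of_nonneg (by linarith), abs_of_nonneg (by linarith)]
      exact (hlam hx hy h).1
    · have := hlam_mono.monotoneOn hy hx h
      rw [abs_of_nonneg (by linarith), abs_of_nonneg (by linarith)]
      exact (hlam hy hx h).1
  have hIoo : ∀ s ∈ Ioo 0 tb, lam s ∈ Ioo 0 tb := by
    intro s hs
    have hs' := Ioo_subset_Icc_self hs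
    have h0 := hlam_mono ⟨le_rfl, htb.le⟩ hs' hs.1
    have h1 := hlam_mono hs' ⟨htb.le, le_rfl⟩ hs.2
    rw [hlam0] at h0
    rw [hlamt] at h1
    exact ⟨h0, h1⟩
  have hΔ : ∀ s ∈ Ioo 0 tb, 0 < γ₂ (lam s) - γ₁ s := fun s hs => by
    linarith [(hsign s hs).1, (hsign _ (hIoo s hs)).2]
  have hmaps := hlam_bij.mapsTo
  have hsub : Ioo 0 tb ⊆ Icc 0 tb := Ioo_subset_Icc_self
  set a : ℝ → ℝ := fun s => (φ₂ (lam s) - φ₁ s) / (γ₂ (lam s) - γ₁ s) with ha_def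
  set c : ℝ → ℝ := fun s => s + 4 * γ₁ s * φ₁ s - 2 * a s * γ₁ s ^ 2 with hc_def
  have ha : LocallyLipschitzOn (Ioo 0 tb) a := by
    have h1 : LocallyLipschitzOn (Ioo 0 tb)
        (fun s => (φ₂ (lam s) - φ₁ s, γ₂ (lam s) - γ₁ s)) := fun s hs =>
      ⟨_, _, self_mem_nhdsWithin,
        ((((hφ₂lip.comp hlamlip hmaps).sub hφ₁lip).prodMk
          ((hγ₂lip.comp hlamlip hmaps).sub hγ₁lip)).mono hsub)⟩
    exact h1.contDiffAt_comp (g := fun z : ℝ × ℝ => z.1 / z.2) fun s hs =>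
      contDiffAt_fst.div contDiffAt_snd (hΔ s hs).ne'
  have hγ₁c := hγ₁lip.continuousOn.mono hsub
  have hφ₁c := hφ₁lip.continuousOn.mono hsub
  have hBc : ContinuousOn (fun s => γ₂ (lam s)) (Ioo 0 tb) :=
    ((hγ₂lip.comp hlamlip hmaps).continuousOn).mono hsub
  have hac := ha.continuousOn
  have hcc : ContinuousOn c (Ioo 0 tb) := by fun_prop
  have hmono : ∀ u ∈ Ioo 0 tb, ∀ v ∈ Ioo 0 tb, u ≤ v → ∀ y ∈ Ioo (γ₁ u) (γ₂ (lam u)),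
      y ∈ Ioo (γ₁ v) (γ₂ (lam v)) →
      1 / 4 * (v - u) ≤ (c v + 2 * a v * y ^ 2) - (c u + 2 * a u * y ^ 2) := by
    intro u hu v hv huv y hyu hyv
    have h := ruling_height_strict_mono hγ₁lip hγ₁bd hγ₂bd hφ₁lip hφ₂lip hφ₁bd hφ₂bd hsign
      hγ₁0 hγ₁t hγ₂0 hγ₂t hφ0 hφt hconv hconc hsmall hlam hlam0 hlamt hu hv huv hyu hyv
    refine h.trans (le_of_eq ?_)
    simp only [hc_def, ha_def]
    ring
  have hRho : ∀ h : ℝ, ∀ s ∈ Ioo 0 tb, piR (heisRho γ₁ γ₂ φ₁ φ₂ lam (h, s)) =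
      (γ₁ s + h * (γ₂ (lam s) - γ₁ s),
        c s + 2 * a s * (γ₁ s + h * (γ₂ (lam s) - γ₁ s)) ^ 2) := fun h s hs =>
    piR_heisRho (hlam_sol s (hsub hs)) (hΔ s hs).ne'
  have hyI : ∀ h ∈ Ioo (0 : ℝ) 1, ∀ s ∈ Ioo 0 tb,
      γ₁ s + h * (γ₂ (lam s) - γ₁ s) ∈ Ioo (γ₁ s) (γ₂ (lam s)) := by
    intro h hh s hs
    have h1 := mul_pos hh.1 (hΔ s hs)
    have h2 := mul_pos (sub_pos.2 hh.2) (hΔ s hs)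
    constructor <;> linarith
  have hmemD : ∀ w, w ∈ Dr ↔ ∃ s ∈ Ioo 0 tb, w.1 ∈ Ioo (γ₁ s) (γ₂ (lam s)) ∧
      w.2 = c s + 2 * a s * w.1 ^ 2 := by
    intro w
    rw [hDr]
    constructor
    · rintro ⟨_, ⟨⟨h, s⟩, ⟨hh, hs⟩, rfl⟩, rfl⟩
      refine ⟨s, hs, ?_⟩
      rw [hRho h s hs]
      exact ⟨hyI h hh s hs, rfl⟩
    · rintro ⟨s, hs, hy, hw⟩
      have hd := hΔ s hs
      refine ⟨_, ⟨((w.1 - γ₁ s) / (γ₂ (lam s) - γ₁ s), s), ⟨⟨?_, ?_⟩, hs⟩, rfl⟩, ?_⟩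
      · exact div_pos (by linarith [hy.1]) hd
      · exact (div_lt_one hd).2 (by linarith [hy.2])
      · rw [hRho _ s hs, div_mul_cancel₀ _ hd.ne', add_sub_cancel, ← hw]
  obtain ⟨hDopen, α, hα, hαlip⟩ := exists_locallyLipschitzOn_parabola_parameter
    (by norm_num : (0 : ℝ) < 1 / 4) hγ₁c hBc ha hcc hmono hmemD
  have hCopen : IsOpen {q : ℝ × ℝ × ℝ | piR q ∈ Dr} := hDopen.preimage contDiff_piR.continuous
  have hβ : LocallyLipschitzOn {q : ℝ × ℝ × ℝ | piR q ∈ Dr} (α ∘ piR) :=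
    hαlip.comp_mapsTo contDiff_piR.locallyLipschitz.locallyLipschitzOn fun q hq => hq
  refine ⟨fun q => 1 / √(1 + (α ∘ piR) q ^ 2),
    fun q => -(α ∘ piR) q / √(1 + (α ∘ piR) q ^ 2), ?_, ?_, ?_, ?_⟩
  · intro p hp
    have hpos : ∀ x : ℝ, 1 + x ^ 2 ≠ 0 := fun x => by positivity
    have hpos' : ∀ x : ℝ, √(1 + x ^ 2) ≠ 0 := fun x => by positivity
    have hsqrt : ∀ x : ℝ, ContDiffAt ℝ 1 (fun x : ℝ => √(1 + x ^ 2)) x := fun x =>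
      ContDiffAt.sqrt (by fun_prop) (hpos x)
    exact LocallyLipschitzOn.exists_ball
      (hβ.contDiffAt_comp (g := fun x : ℝ => 1 / √(1 + x ^ 2)) fun q _ =>
        contDiffAt_const.div (hsqrt _) (hpos' _))
      (hβ.contDiffAt_comp (g := fun x : ℝ => -x / √(1 + x ^ 2)) fun q _ =>
        contDiffAt_id.neg.div (hsqrt _) (hpos' _)) hp
  · intro p _
    have hpos : 0 < 1 + (α ∘ piR) p ^ 2 := by positivity
    rw [div_pow, div_pow, Real.sq_sqrt hpos.le]
    field_simp
  · have : (volume : Measure (ℝ × ℝ)).IsAddHaarMeasure :=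
      Measure.prod.instIsAddHaarMeasure volume volume
    have : (volume : Measure (ℝ × ℝ × ℝ)).IsAddHaarMeasure :=
      Measure.prod.instIsAddHaarMeasure volume volume
    filter_upwards [hβ.ae_differentiableAt (μ := volume) hCopen,
      ae_restrict_mem hCopen.measurableSet] with p hd hp
    obtain ⟨s, hs, hy, hw⟩ := (hmemD _).1 hp
    refine horizontal_divergence_eq_zero hd ?_
    have hp' : piR p = (p.2.1, c s + 2 * a s * p.2.1 ^ 2) := Prod.ext rfl hw
    have hval : (α ∘ piR) p = a s := by
      rw [Function.comp_apply, hp']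
      exact hα s hs _ hy
    rw [hval]
    exact hasLineDerivAt_comp_piR isOpen_Ioo (hα s hs) hy hp'
  · intro h hh s hs
    have hd := hΔ s hs
    have hval : (α ∘ piR) (heisRho γ₁ γ₂ φ₁ φ₂ lam (h, s)) = a s := by
      rw [Function.comp_apply, hRho h s hs]
      exact hα s hs _ (hyI h hh s hs)
    simp only [hval]
    have e : √((γ₂ (lam s) - γ₁ s) ^ 2 + (φ₂ (lam s) - φ₁ s) ^ 2)
        = (γ₂ (lam s) - γ₁ s) * √(1 + a s ^ 2) := by
      rw [← Real.sqrt_sq hd.le, ← Real.sqrt_mul (sq_nonneg _), Real.sqrt_sq hd.le]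
      congr 1
      simp only [ha_def]
      field_simp
    have hq : √(1 + a s ^ 2) ≠ 0 := by positivity
    have hd' := hd.ne'
    rw [e]
    constructor
    · field_simp
    · simp only [ha_def] at hq ⊢
      field_simp
end
end
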